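/- Let $k$ be an algebraically closed field, let $V\subseteq\mathbb P^n$ and $W\subseteq\mathbb P^m$ be smooth projective varieties (integral closed subschemes) over $k$ with homogeneous ideals $I(V)\subset k[x_0,\dots,x_n]$ and $I(W)\subset k[y_0,\dots,y_m]$, and let $p\in V$ be a closed point. Embed $V\times W$ in $\mathbb P^N$, $N=(n+1)(m+1)-1$, with coordinates $z_{ij}$, by the Segre embedding. For homogeneous ideals $I\subset k[x_0,\dots,x_n]$ and $J\subset k[y_0,\dots,y_m]$, the cone over $\operatorname{Proj}(k[x]/I)\times\operatorname{Proj}(k[y]/J)\subseteq\mathbb P^N$ (relative to $I$ and $J$) is the closed subscheme of $\mathbb A^{N+1}$ defined by the kernel of $k[z_{ij}]\to (k[x]/I)\otimes_k(k[y]/J)$, $z_{ij}\mapsto x_i\otimes y_j$. Let $Y=C(V\times W)$ be the cone for $I=I(V)$, $J=I(W)$, and let $v\in Y$ be its vertex (the origin). Let $H\subset W$ be such that $\{p\}\times H$ is the scheme-theoretic intersection of $\{p\}\times W$ with a hyperplane of $\mathbb P^N$ not containing $\{p\}\times W$; thus $H=\operatorname{Proj}\bigl(k[y]/(I(W)+(\ell))\bigr)$,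 where the linear form $\ell\notin I(W)$ is the restriction to $\{p\}\times\mathbb P^m$ of the equation of the hyperplane. Let $Z=C(V\times H)\subset Y$ be the cone for $I=I(V)$, $J=I(W)+(\ell)$ (if $\dim W=0$, then $H=\emptyset$ and $Z=\{v\}$). Let $f:X\to Y$ be the blowing up of $Y$ along $Z$. Then $f$ is an isomorphism over $Y\setminus\{v\}$, and the scheme-theoretic preimage $f^{-1}(v)$ is isomorphic to $V$ as a $k$-scheme. If moreover $\dim V>0$, then the support of $f^{-1}(v)$ is the exceptional locus of $f$, that is, the set of points of $X$ at which $f$ is not a local isomorphism. -/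

import Mathlib

universe u

open AlgebraicGeometry CategoryTheory TensorProduct

noncomputable section

namespace ConeBlowup

attribute [local instance] MvPolynomial.gradedAlgebra

/-! ### Gradings and the structure morphism of `Proj` -/

section Quotient

variable {R A : Type u} [CommRing R] [CommRing A] [Algebra R A]
  (𝒜 : ℕ → Submodule R A) [GradedAlgebra 𝒜] (I : HomogeneousIdeal 𝒜)

/-- The grading of `A ⧸ I` induced by a grading of `A`, for a homogeneous ideal `I`:
the piece of degree `d` is the image of the piece of degree `d` of `A`. -/
def quotGrading (d : ℕ) : Submodule R (A ⧸ I.toIdeal) :=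
  (𝒜 d).map (Ideal.Quotient.mkₐ R I.toIdeal).toLinearMap

instance quotGrading_gradedMonoid : SetLike.GradedMonoid (quotGrading 𝒜 I) where
  one_mem := ⟨1, SetLike.GradedOne.one_mem, by simp⟩
  mul_mem := by
    rintro i j _ _ ⟨a, ha, rfl⟩ ⟨b, hb, rfl⟩
    exact ⟨a * b, SetLike.GradedMul.mul_mem ha hb, by simp⟩

/-- The quotient map in degree `d`. -/
def quotPiece (d : ℕ) : 𝒜 d →ₗ[R] quotGrading 𝒜 I d :=
  ((Ideal.Quotient.mkₐ R I.toIdeal).toLinearMap.domRestrict (𝒜 d)).codRestrict _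
    (fun a => ⟨a, a.2, rfl⟩)

/-- An element of `A` is sent to the family of the classes of its homogeneous components. -/
def quotDecomposeAux : A →+ DirectSum ℕ (fun d => quotGrading 𝒜 I d) :=
  (DirectSum.lmap (quotPiece 𝒜 I)).toAddMonoidHom.comp
    (DirectSum.decomposeAddEquiv 𝒜).toAddMonoidHom

theorem quotDecomposeAux_apply (a : A) (d : ℕ) :
    ((quotDecomposeAux 𝒜 I a d : quotGrading 𝒜 I d) : A ⧸ I.toIdeal) =
      Ideal.Quotient.mk I.toIdeal (DirectSum.decompose 𝒜 a d : A) := rfl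

theorem quotDecomposeAux_coe {d : ℕ} (a : 𝒜 d) :
    quotDecomposeAux 𝒜 I a = DirectSum.of (fun d => quotGrading 𝒜 I d) d (quotPiece 𝒜 I d a) := by
  change DirectSum.lmap (quotPiece 𝒜 I) (DirectSum.decompose 𝒜 (a : A)) = _
  rw [DirectSum.decompose_coe, DirectSum.lmap_of]

/-- The decomposition of `A ⧸ I` into homogeneous components. -/
def quotDecompose : (A ⧸ I.toIdeal) →+ DirectSum ℕ (fun d => quotGrading 𝒜 I d) :=
  QuotientAddGroup.lift (Submodule.toAddSubgroup I.toIdeal) (quotDecomposeAux 𝒜 I) (by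
    intro a ha
    refine DFinsupp.ext fun d => Subtype.ext ?_
    change Ideal.Quotient.mk I.toIdeal (DirectSum.decompose 𝒜 a d : A) = 0
    exact Ideal.Quotient.eq_zero_iff_mem.mpr (I.isHomogeneous d ha))

theorem quotDecompose_mk (a : A) :
    quotDecompose 𝒜 I (Ideal.Quotient.mk I.toIdeal a) = quotDecomposeAux 𝒜 I a := rfl

instance quotGrading_gradedAlgebra : GradedAlgebra (quotGrading 𝒜 I) where
  toGradedMonoid := quotGrading_gradedMonoid 𝒜 I
  toDecomposition := DirectSum.Decomposition.ofAddHom _ (quotDecompose 𝒜 I)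
    (by
      refine AddMonoidHom.ext fun x => ?_
      obtain ⟨a, rfl⟩ := Ideal.Quotient.mk_surjective x
      change DirectSum.coeAddMonoidHom (quotGrading 𝒜 I) (quotDecomposeAux 𝒜 I a) =
        Ideal.Quotient.mk I.toIdeal a
      induction a using DirectSum.Decomposition.inductionOn 𝒜 with
      | zero => simp
      | homogeneous m =>
        rw [quotDecomposeAux_coe, DirectSum.coeAddMonoidHom_of]
        rfl
      | add a b ha hb => simp only [map_add, ha, hb])
    (by
      refine DirectSum.addHom_ext' fun i => AddMonoidHom.ext ?_
      rintro ⟨_, a, ha, rfl⟩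
      change quotDecompose 𝒜 I (DirectSum.coeAddMonoidHom (quotGrading 𝒜 I) _) = _
      rw [DirectSum.coeAddMonoidHom_of]
      exact quotDecomposeAux_coe 𝒜 I ⟨a, ha⟩)

end Quotient

/-- The structure morphism `Proj A ⟶ Spec R` of a graded `R`-algebra `A`. -/
def projToSpec {R A : Type u} [CommRing R] [CommRing A] [Algebra R A]
    (𝒜 : ℕ → Submodule R A) [GradedAlgebra 𝒜] : Proj 𝒜 ⟶ Spec (.of R) :=
  Proj.toSpecZero 𝒜 ≫ Spec.map (CommRingCat.ofHom (algebraMap R (𝒜 0)))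

/-! ### Blowing up an affine scheme along an ideal -/

section Rees

open Polynomial

variable {A : Type u} [CommRing A] (I : Ideal A)

/-- The grading of the Rees algebra `⨁ Iᵈ tᵈ ⊆ A[t]`: the piece of degree `d` is `Iᵈ tᵈ`. -/
def reesGrading (d : ℕ) : Submodule A (reesAlgebra I) :=
  (LinearMap.range (monomial d : A →ₗ[A] A[X])).comap (reesAlgebra I).val.toLinearMap

theorem mem_reesGrading {d : ℕ} {f : reesAlgebra I} :
    f ∈ reesGrading I d ↔ ∃ a : A, monomial d a = (f : A[X]) := Iff.rfl

instance reesGrading_gradedMonoid : SetLike.GradedMonoid (reesGrading I) where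
  one_mem := ⟨1, by simp⟩
  mul_mem := by
    rintro i j f g ⟨a, ha⟩ ⟨b, hb⟩
    refine ⟨a * b, ?_⟩
    change monomial (i + j) (a * b) = (f : A[X]) * (g : A[X])
    rw [← monomial_mul_monomial]
    exact congrArg₂ (· * ·) ha hb

/-- The component of degree `d` of an element of the Rees algebra. -/
def reesComponent (f : reesAlgebra I) (d : ℕ) : reesGrading I d :=
  ⟨⟨monomial d ((f : A[X]).coeff d), reesAlgebra.monomial_mem.mpr (f.2 d)⟩, _, rfl⟩

theorem reesComponent_coe (x : DirectSum ℕ (fun d => reesGrading I d)) (d : ℕ) :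
    reesComponent I (DirectSum.coeAddMonoidHom (reesGrading I) x) d = x d := by
  refine Subtype.ext (Subtype.ext ?_)
  change monomial d (((DirectSum.coeAddMonoidHom (reesGrading I) x : reesAlgebra I) :
    A[X]).coeff d) = ((x d : reesAlgebra I) : A[X])
  induction x using DirectSum.induction_on with
  | zero => simp
  | of i y =>
    obtain ⟨y, a, ha⟩ := y
    have ha' : monomial i a = (y : A[X]) := ha
    rw [DirectSum.coeAddMonoidHom_of]
    by_cases h : i = d
    · subst h
      rw [DirectSum.of_eq_same]
      simp [← ha']
    · rw [DirectSum.of_eq_of_ne _ _ _ (Ne.symm h)]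
      simp [← ha', coeff_monomial, h]
  | add x y hx hy =>
    rw [map_add, DirectSum.add_apply]
    push_cast
    rw [coeff_add, map_add, hx, hy]

instance reesGrading_gradedAlgebra : GradedAlgebra (reesGrading I) where
  toGradedMonoid := reesGrading_gradedMonoid I
  decompose' f := ∑ d ∈ (f : A[X]).support,
    DirectSum.of (fun d => reesGrading I d) d (reesComponent I f d)
  left_inv f := by
    rw [map_sum]
    simp only [DirectSum.coeAddMonoidHom_of]
    apply Subtype.ext
    conv_rhs => rw [(f : A[X]).as_sum_support]
    simp [reesComponent]
  right_inv x := by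
    refine DFinsupp.ext fun d => ?_
    rw [← reesComponent_coe I x d]
    generalize DirectSum.coeAddMonoidHom (reesGrading I) x = f
    change (∑ e ∈ (f : A[X]).support,
      DirectSum.of (fun d => reesGrading I d) e (reesComponent I f e)) d = _
    rw [DFinsupp.finsetSum_apply]
    by_cases hd : d ∈ (f : A[X]).support
    · rw [Finset.sum_eq_single_of_mem d hd]
      · exact DirectSum.of_eq_same _ _
      · intro e _ he
        exact DirectSum.of_eq_of_ne _ _ _ he.symm
    · rw [Finset.sum_eq_zero]
      · refine Subtype.ext (Subtype.ext ?_)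
        simp [reesComponent, notMem_support_iff.mp hd]
      · intro e he
        refine DirectSum.of_eq_of_ne _ _ _ ?_
        rintro rfl
        exact hd he

/-- The blowing up of `Spec A` along the closed subscheme defined by `I`,
that is `Proj (⨁ Iᵈ)`. -/
def affineBlowup : Scheme.{u} := Proj (reesGrading I)

/-- The blowing up morphism `Proj (⨁ Iᵈ) ⟶ Spec A`. -/
def affineBlowupMap : affineBlowup I ⟶ Spec (.of A) := projToSpec (reesGrading I)

end Rees

/-! ### Projective varieties, the Segre embedding and cones -/

section Varieties

variable (k : Type u) [Field k]

/-- A projective variety `V ⊆ ℙⁿ` over `k`, that is an integral closed subscheme, given by its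
homogeneous ideal `I(V) ⊆ k[x₀, …, xₙ]`: a homogeneous prime ideal that does not contain
all the coordinates. -/
structure ProjVariety (n : ℕ) where
  ideal : HomogeneousIdeal (MvPolynomial.homogeneousSubmodule (Fin (n + 1)) k)
  isPrime : ideal.toIdeal.IsPrime
  exists_notMem : ∃ i, (MvPolynomial.X i : MvPolynomial (Fin (n + 1)) k) ∉ ideal.toIdeal

variable {k}

namespace ProjVariety

variable {n : ℕ} (V : ProjVariety k n)

/-- The scheme `V = Proj (k[x₀, …, xₙ] ⧸ I(V))`. -/
def toScheme : Scheme.{u} := Proj (quotGrading _ V.ideal)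

/-- The structure morphism `V ⟶ Spec k`. -/
def toSpec : V.toScheme ⟶ Spec (.of k) := projToSpec (quotGrading _ V.ideal)

/-- The vector `p` is a vector of homogeneous coordinates of a closed point of `V`
(for `k` algebraically closed). -/
def IsPoint (p : Fin (n + 1) → k) : Prop :=
  p ≠ 0 ∧ ∀ g ∈ V.ideal.toIdeal, MvPolynomial.eval p g = 0

theorem le_ker_aeval_zero :
    V.ideal.toIdeal ≤ RingHom.ker (MvPolynomial.aeval (0 : Fin (n + 1) → k) :
      MvPolynomial (Fin (n + 1)) k →ₐ[k] k) := by
  intro g hg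
  by_contra h
  rw [RingHom.mem_ker, MvPolynomial.aeval_zero, Algebra.algebraMap_self, RingHom.id_apply] at h
  have h0 := (MvPolynomial.mem_iff_homogeneousComponent_mem V.ideal.isHomogeneous g).mp hg 0
  rw [MvPolynomial.homogeneousComponent_zero] at h0
  exact V.isPrime.ne_top (Ideal.eq_top_of_isUnit_mem _ h0
    ((isUnit_iff_ne_zero.mpr h).map MvPolynomial.C))

end ProjVariety

variable {n m : ℕ}

/-- The Segre homomorphism `z_{ij} ↦ x_i ⊗ y_j` from the homogeneous coordinate ring of `ℙᴺ` to
the bihomogeneous coordinate ring of the product of the closed subschemes of `ℙⁿ` and `ℙᵐ`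
defined by the homogeneous ideals `I` and `J`. -/
def segreHom (I : Ideal (MvPolynomial (Fin (n + 1)) k))
    (J : Ideal (MvPolynomial (Fin (m + 1)) k)) :
    MvPolynomial (Fin (n + 1) × Fin (m + 1)) k →ₐ[k]
      (MvPolynomial (Fin (n + 1)) k ⧸ I) ⊗[k] (MvPolynomial (Fin (m + 1)) k ⧸ J) :=
  MvPolynomial.aeval fun ij =>
    Ideal.Quotient.mk I (MvPolynomial.X ij.1) ⊗ₜ[k] Ideal.Quotient.mk J (MvPolynomial.X ij.2)

/-- The ideal, in the coordinate ring `k[z_{ij}]` of `𝔸ᴺ⁺¹`, of the cone over the Segre product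
`Proj (k[x] ⧸ I) × Proj (k[y] ⧸ J) ⊆ ℙᴺ`. -/
def segreIdeal (I : Ideal (MvPolynomial (Fin (n + 1)) k))
    (J : Ideal (MvPolynomial (Fin (m + 1)) k)) :
    Ideal (MvPolynomial (Fin (n + 1) × Fin (m + 1)) k) :=
  RingHom.ker (segreHom I J)

variable (V : ProjVariety k n) (W : ProjVariety k m)

/-- The coordinate ring of the cone `C(V × W) ⊆ 𝔸ᴺ⁺¹`. -/
abbrev ConeRing : Type u :=
  MvPolynomial (Fin (n + 1) × Fin (m + 1)) k ⧸ segreIdeal V.ideal.toIdeal W.ideal.toIdeal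

/-- The cone `Y = C(V × W)`. -/
def cone : Scheme.{u} := Spec (.of (ConeRing V W))

/-- The structure morphism `C(V × W) ⟶ Spec k`. -/
def coneToSpec : cone V W ⟶ Spec (.of k) :=
  Spec.map (CommRingCat.ofHom (algebraMap k (ConeRing V W)))

theorem segreIdeal_le_ker :
    segreIdeal V.ideal.toIdeal W.ideal.toIdeal ≤
      RingHom.ker (MvPolynomial.aeval (0 : Fin (n + 1) × Fin (m + 1) → k) :
        MvPolynomial (Fin (n + 1) × Fin (m + 1)) k →ₐ[k] k) := by
  let e : (MvPolynomial (Fin (n + 1)) k ⧸ V.ideal.toIdeal) ⊗[k]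
      (MvPolynomial (Fin (m + 1)) k ⧸ W.ideal.toIdeal) →ₐ[k] k :=
    Algebra.TensorProduct.lift
      (Ideal.Quotient.liftₐ _ (MvPolynomial.aeval 0) V.le_ker_aeval_zero)
      (Ideal.Quotient.liftₐ _ (MvPolynomial.aeval 0) W.le_ker_aeval_zero)
      (fun _ _ => Commute.all _ _)
  have h : e.comp (segreHom V.ideal.toIdeal W.ideal.toIdeal) = MvPolynomial.aeval 0 := by
    refine MvPolynomial.algHom_ext fun ij => ?_
    have hX : Ideal.Quotient.liftₐ V.ideal.toIdeal (MvPolynomial.aeval (0 : Fin (n + 1) → k))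
        V.le_ker_aeval_zero (Ideal.Quotient.mk _ (MvPolynomial.X ij.1)) = 0 :=
      MvPolynomial.aeval_X _ _
    simp [e, segreHom, hX]
  intro g hg
  rw [RingHom.mem_ker, ← h, AlgHom.comp_apply, (RingHom.mem_ker.mp hg : _ = _), map_zero]

/-- Evaluation of a function on the cone at the origin of `𝔸ᴺ⁺¹`. -/
def evalVertex : ConeRing V W →ₐ[k] k :=
  Ideal.Quotient.liftₐ _ (MvPolynomial.aeval 0) (segreIdeal_le_ker V W)

/-- The vertex `v` of `C(V × W)`: the origin of `𝔸ᴺ⁺¹`. -/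
def vertex : cone V W :=
  (⟨RingHom.ker (evalVertex V W), RingHom.ker_isPrime _⟩ : PrimeSpectrum (ConeRing V W))

theorem isClosed_vertex : IsClosed ({vertex V W} : Set (cone V W)) := by
  refine (PrimeSpectrum.isClosed_singleton_iff_isMaximal _).mpr ?_
  refine RingHom.ker_isMaximal_of_surjective (evalVertex V W) fun c => ⟨algebraMap k _ c, ?_⟩
  simp

/-- The open subscheme `Y ∖ {v}` of the cone `Y`. -/
def punctured : (cone V W).Opens := ⟨{vertex V W}ᶜ, (isClosed_vertex V W).isOpen_compl⟩

/-- The restriction `L(z) ↦ L(pᵢ yⱼ)` of forms on `ℙᴺ` to `{p} × ℙᵐ ≅ ℙᵐ`. -/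
def restrictToSlice (p : Fin (n + 1) → k) :
    MvPolynomial (Fin (n + 1) × Fin (m + 1)) k →ₐ[k] MvPolynomial (Fin (m + 1)) k :=
  MvPolynomial.aeval fun ij => MvPolynomial.C (p ij.1) * MvPolynomial.X ij.2

/-- The closed subscheme `H = Proj (k[y] ⧸ J) ⊆ W` is such that `{p} × H` is a hyperplane section
of `{p} × W ⊆ ℙᴺ`: its defining equations are those of `W` and the restriction to `{p} × W` of the
equation `L` of a hyperplane in `ℙᴺ` not containing `{p} × W`. -/
def IsHyperplaneSection (p : Fin (n + 1) → k) (J : Ideal (MvPolynomial (Fin (m + 1)) k)) : Prop :=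
  ∃ L : MvPolynomial (Fin (n + 1) × Fin (m + 1)) k, L.IsHomogeneous 1 ∧
    restrictToSlice p L ∉ W.ideal.toIdeal ∧
    J = W.ideal.toIdeal ⊔ Ideal.span {restrictToSlice p L}

/-- The ideal of `Z = C(V × H)` in the coordinate ring of `Y = C(V × W)`, where
`H = Proj (k[y] ⧸ J) ⊆ W`. -/
def subconeIdeal (J : Ideal (MvPolynomial (Fin (m + 1)) k)) : Ideal (ConeRing V W) :=
  (segreIdeal V.ideal.toIdeal J).map
    (Ideal.Quotient.mk (segreIdeal V.ideal.toIdeal W.ideal.toIdeal))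

/-- The blowing up `X` of `Y = C(V × W)` along `Z = C(V × H)`. -/
def coneBlowup (J : Ideal (MvPolynomial (Fin (m + 1)) k)) : Scheme.{u} :=
  affineBlowup (subconeIdeal V W J)

/-- The blowing up morphism `f : X ⟶ Y`. -/
def coneBlowupMap (J : Ideal (MvPolynomial (Fin (m + 1)) k)) : coneBlowup V W J ⟶ cone V W :=
  affineBlowupMap (subconeIdeal V W J)

end Varieties

/-- The exceptional locus of a morphism `f : X ⟶ Y`: the set of points of `X` at which `f` is not a
local isomorphism, i.e. the complement of the union of all open `U ⊆ X` such that
`f` restricts to an isomorphism of `U` with an open subscheme of `Y`. -/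
def exceptionalLocus {X Y : Scheme.{u}} (f : X ⟶ Y) : Set X :=
  {x | ∀ U : X.Opens, x ∈ U → ¬ IsOpenImmersion (U.ι ≫ f)}

end ConeBlowup

end

noncomputable section

namespace ConeBlowup

attribute [local instance] MvPolynomial.gradedAlgebra

/-! ### The ideal of the subcone -/

section Segre

open MvPolynomial

variable {k : Type u} [Field k] {n m : ℕ}

/-- The weight on `k[x, y]` for which the `xᵢ` have weight `1` and the `yⱼ` have weight `-1`. -/
def diffWeight (n m : ℕ) : Fin (n + 1) ⊕ Fin (m + 1) → ℤ := Sum.elim (fun _ => 1) (fun _ => -1)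

/-- The Segre homomorphism `z_{ij} ↦ xᵢ yⱼ` into `k[x, y]`. -/
def segrePoly (k : Type u) [Field k] (n m : ℕ) :
    MvPolynomial (Fin (n + 1) × Fin (m + 1)) k →ₐ[k]
      MvPolynomial (Fin (n + 1) ⊕ Fin (m + 1)) k :=
  aeval fun ij => X (Sum.inl ij.1) * X (Sum.inr ij.2)

/-- The ideal of `k[x, y]` generated by `I ⊆ k[x]` and `J ⊆ k[y]`. -/
def joinIdeal (I : Ideal (MvPolynomial (Fin (n + 1)) k))
    (J : Ideal (MvPolynomial (Fin (m + 1)) k)) :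
    Ideal (MvPolynomial (Fin (n + 1) ⊕ Fin (m + 1)) k) :=
  I.map (rename Sum.inl : _ →ₐ[k] MvPolynomial (Fin (n + 1) ⊕ Fin (m + 1)) k) ⊔
    J.map (rename Sum.inr : _ →ₐ[k] MvPolynomial (Fin (n + 1) ⊕ Fin (m + 1)) k)

/-- The homomorphism `k[x, y] → (k[x] ⧸ I) ⊗ (k[y] ⧸ J)`. -/
def toTensor (I : Ideal (MvPolynomial (Fin (n + 1)) k))
    (J : Ideal (MvPolynomial (Fin (m + 1)) k)) :
    MvPolynomial (Fin (n + 1) ⊕ Fin (m + 1)) k →ₐ[k]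
      (MvPolynomial (Fin (n + 1)) k ⧸ I) ⊗[k] (MvPolynomial (Fin (m + 1)) k ⧸ J) :=
  aeval (Sum.elim (fun i => Ideal.Quotient.mk I (X i) ⊗ₜ[k] 1)
    (fun j => 1 ⊗ₜ[k] Ideal.Quotient.mk J (X j)))

theorem toTensor_comp_segrePoly (I : Ideal (MvPolynomial (Fin (n + 1)) k))
    (J : Ideal (MvPolynomial (Fin (m + 1)) k)) :
    (toTensor I J).comp (segrePoly k n m) = segreHom I J := by
  refine algHom_ext fun ij => ?_
  simp [toTensor, segrePoly, segreHom]

theorem toTensor_rename_inl (I : Ideal (MvPolynomial (Fin (n + 1)) k))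
    (J : Ideal (MvPolynomial (Fin (m + 1)) k)) (g : MvPolynomial (Fin (n + 1)) k) :
    toTensor I J (rename Sum.inl g) = Ideal.Quotient.mk I g ⊗ₜ[k] 1 := by
  have : (toTensor I J).comp (rename Sum.inl) =
      Algebra.TensorProduct.includeLeft.comp (Ideal.Quotient.mkₐ k I) := by
    refine algHom_ext fun i => ?_
    simp [toTensor]
  exact DFunLike.congr_fun this g

theorem toTensor_rename_inr (I : Ideal (MvPolynomial (Fin (n + 1)) k))
    (J : Ideal (MvPolynomial (Fin (m + 1)) k)) (g : MvPolynomial (Fin (m + 1)) k) :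
    toTensor I J (rename Sum.inr g) = 1 ⊗ₜ[k] Ideal.Quotient.mk J g := by
  have : (toTensor I J).comp (rename Sum.inr) =
      Algebra.TensorProduct.includeRight.comp (Ideal.Quotient.mkₐ k J) := by
    refine algHom_ext fun i => ?_
    simp [toTensor]
  exact DFunLike.congr_fun this g

theorem ker_toTensor (I : Ideal (MvPolynomial (Fin (n + 1)) k))
    (J : Ideal (MvPolynomial (Fin (m + 1)) k)) :
    RingHom.ker (toTensor I J) = joinIdeal I J := by
  apply le_antisymm
  · let e : (MvPolynomial (Fin (n + 1)) k ⧸ I) ⊗[k] (MvPolynomial (Fin (m + 1)) k ⧸ J) →ₐ[k]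
        MvPolynomial (Fin (n + 1) ⊕ Fin (m + 1)) k ⧸ joinIdeal I J :=
      Algebra.TensorProduct.lift
        (Ideal.Quotient.liftₐ I ((Ideal.Quotient.mkₐ k (joinIdeal I J)).comp (rename Sum.inl))
          fun a ha => Ideal.Quotient.eq_zero_iff_mem.mpr
            ((le_sup_left : _ ≤ joinIdeal I J) (Ideal.mem_map_of_mem _ ha)))
        (Ideal.Quotient.liftₐ J ((Ideal.Quotient.mkₐ k (joinIdeal I J)).comp (rename Sum.inr))
          fun a ha => Ideal.Quotient.eq_zero_iff_mem.mpr
            ((le_sup_right : _ ≤ joinIdeal I J) (Ideal.mem_map_of_mem _ ha)))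
        (fun _ _ => Commute.all _ _)
    have he : e.comp (toTensor I J) = Ideal.Quotient.mkₐ k (joinIdeal I J) := by
      refine algHom_ext fun i => ?_
      rcases i with i | j
      · rw [AlgHom.comp_apply, toTensor, aeval_X, Sum.elim_inl, Algebra.TensorProduct.lift_tmul,
          map_one, mul_one]
        change Ideal.Quotient.mk (joinIdeal I J) (rename Sum.inl (X i)) = _
        rw [rename_X]
        rfl
      · rw [AlgHom.comp_apply, toTensor, aeval_X, Sum.elim_inr, Algebra.TensorProduct.lift_tmul,
          map_one, one_mul]
        change Ideal.Quotient.mk (joinIdeal I J) (rename Sum.inr (X j)) = _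
        rw [rename_X]
        rfl
    intro g hg
    rw [← Ideal.Quotient.eq_zero_iff_mem]
    have := DFunLike.congr_fun he g
    rw [AlgHom.comp_apply, (RingHom.mem_ker.mp hg : toTensor I J g = 0), map_zero] at this
    exact this.symm
  · refine sup_le (Ideal.map_le_iff_le_comap.mpr fun g hg => ?_)
      (Ideal.map_le_iff_le_comap.mpr fun g hg => ?_)
    · change toTensor I J (rename Sum.inl g) = 0
      rw [toTensor_rename_inl, Ideal.Quotient.eq_zero_iff_mem.mpr hg, TensorProduct.zero_tmul]
    · change toTensor I J (rename Sum.inr g) = 0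
      rw [toTensor_rename_inr, Ideal.Quotient.eq_zero_iff_mem.mpr hg, TensorProduct.tmul_zero]

theorem isWeightedHomogeneous_rename {σ τ M : Type*} [AddCommMonoid M] (f : σ → τ)
    (w : τ → M) (a : M) (hw : ∀ i, w (f i) = a) {g : MvPolynomial σ k} {d : ℕ}
    (hg : g.IsHomogeneous d) : IsWeightedHomogeneous w (rename f g) (d • a) := by
  intro e he
  obtain ⟨u, rfl, hu⟩ := coeff_rename_ne_zero f g e he
  have h1 := hg hu
  rw [Finsupp.weight_apply] at h1 ⊢
  rw [Finsupp.sum_mapDomain_index (by simp) (by simp [add_smul])]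
  rw [← h1]
  simp [hw, Finsupp.sum, Finset.sum_smul]

attribute [local instance] MvPolynomial.weightedGradedAlgebra

theorem isHomogeneous_map_rename {σ τ : Type*} (f : σ → τ) (w : τ → ℤ) (a : ℤ)
    (hw : ∀ i, w (f i) = a) {I : Ideal (MvPolynomial σ k)}
    (hI : I.IsHomogeneous (homogeneousSubmodule σ k)) :
    (I.map (rename f : _ →ₐ[k] MvPolynomial τ k)).IsHomogeneous
      (weightedHomogeneousSubmodule k w) := by
  obtain ⟨S, rfl⟩ := (Ideal.IsHomogeneous.iff_exists _ _).mp hI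
  rw [Ideal.map_span]
  refine Ideal.homogeneous_span _ _ ?_
  rintro _ ⟨_, ⟨⟨g, d, hg⟩, _, rfl⟩, rfl⟩
  exact ⟨_, isWeightedHomogeneous_rename f w a hw hg⟩

theorem isWeightedHomogeneous_segrePoly (g : MvPolynomial (Fin (n + 1) × Fin (m + 1)) k) :
    IsWeightedHomogeneous (diffWeight n m) (segrePoly k n m g) 0 := by
  induction g using MvPolynomial.induction_on with
  | C a => simpa [segrePoly] using isWeightedHomogeneous_C _ a
  | add p q hp hq => rw [map_add]; exact hp.add hq
  | mul_X p ij hp =>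
    rw [map_mul]
    have h1 := (isWeightedHomogeneous_X k (diffWeight n m) (Sum.inl ij.1)).mul
      (isWeightedHomogeneous_X k (diffWeight n m) (Sum.inr ij.2))
    simpa [segrePoly, diffWeight] using hp.mul h1

theorem weight_diffWeight (d : Fin (n + 1) ⊕ Fin (m + 1) →₀ ℕ) :
    Finsupp.weight (diffWeight n m) d =
      ∑ i, (d (Sum.inl i) : ℤ) - ∑ j, (d (Sum.inr j) : ℤ) := by
  rw [Finsupp.weight_apply, Finsupp.sum_fintype _ _ (by simp)]
  simp [diffWeight, sub_eq_add_neg]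

theorem monomial_mem_range_segrePoly (N : ℕ) (d : Fin (n + 1) ⊕ Fin (m + 1) →₀ ℕ)
    (hN : ∑ i, d (Sum.inl i) = N)
    (hd : Finsupp.weight (diffWeight n m) d = 0) :
    monomial d (1 : k) ∈ (segrePoly k n m).range := by
  rw [weight_diffWeight] at hd
  induction N generalizing d with
  | zero =>
    have h1 : ∑ i, d (Sum.inr i) = 0 := by
      zify at hN ⊢; omega
    have : d = 0 := by
      ext i
      rcases i with i | i
      · exact (Finset.sum_eq_zero_iff.mp hN) i (Finset.mem_univ _)
      · exact (Finset.sum_eq_zero_iff.mp h1) i (Finset.mem_univ _)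
    subst this
    exact one_mem _
  | succ N ih =>
    have h1 : ∑ i, d (Sum.inr i) = N + 1 := by
      zify at hN ⊢; omega
    obtain ⟨i, -, hi⟩ := Finset.exists_ne_zero_of_sum_ne_zero (hN.trans_ne (by omega))
    obtain ⟨j, -, hj⟩ := Finset.exists_ne_zero_of_sum_ne_zero (h1.trans_ne (by omega))
    have hle : Finsupp.single (Sum.inl i) 1 + Finsupp.single (Sum.inr j) 1 ≤ d := by
      classical
      intro a
      rcases a with a | a
      · by_cases h : a = i
        · subst h; simp; omega
        · simp [Ne.symm h]
      · by_cases h : a = j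
        · subst h; simp; omega
        · simp [Ne.symm h]
    obtain ⟨e, rfl⟩ := exists_add_of_le hle
    have hs1 : ∑ a, (Finsupp.single (Sum.inl i : Fin (n + 1) ⊕ Fin (m + 1)) 1
        : _ →₀ ℕ) (Sum.inl a) = 1 := by
      classical
      simp [Finsupp.single_apply]
    have hs2 : ∑ a, (Finsupp.single (Sum.inr j : Fin (n + 1) ⊕ Fin (m + 1)) 1
        : _ →₀ ℕ) (Sum.inr a) = 1 := by
      classical
      simp [Finsupp.single_apply]
    have h2 : ∑ a, e (Sum.inl a) = N := by
      simp only [Finsupp.add_apply, Finset.sum_add_distrib, hs1] at hN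
      simp at hN; omega
    have h3 : ∑ a, e (Sum.inr a) = N := by
      simp only [Finsupp.add_apply, Finset.sum_add_distrib, hs2] at h1
      simp at h1; omega
    have := ih e h2 (by zify at h2 h3; omega)
    obtain ⟨g, hg⟩ := this
    refine ⟨X (i, j) * g, ?_⟩
    change segrePoly k n m _ = _
    change segrePoly k n m _ = _ at hg
    rw [map_mul, hg, segrePoly, aeval_X]
    simp only [X, monomial_mul, mul_one]

theorem exists_eq_sum_X_mul_segrePoly {c : MvPolynomial (Fin (n + 1) ⊕ Fin (m + 1)) k}
    (hc : IsWeightedHomogeneous (diffWeight n m) c 1) :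
    ∃ g : Fin (n + 1) → MvPolynomial (Fin (n + 1) × Fin (m + 1)) k,
      c = ∑ i, X (Sum.inl i) * segrePoly k n m (g i) := by
  let M : Submodule k (MvPolynomial (Fin (n + 1) ⊕ Fin (m + 1)) k) :=
    LinearMap.range (∑ i, (LinearMap.mulLeft k (X (Sum.inl i))) ∘ₗ
      (segrePoly k n m).toLinearMap ∘ₗ LinearMap.proj i :
      (Fin (n + 1) → MvPolynomial (Fin (n + 1) × Fin (m + 1)) k) →ₗ[k] _)
  suffices h : c ∈ M by
    obtain ⟨g, hg⟩ := h
    exact ⟨g, by simpa using hg.symm⟩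
  rw [c.as_sum]
  refine Submodule.sum_mem _ fun d hd => ?_
  have hw := hc (mem_support_iff.mp hd)
  rw [← mul_one (coeff d c), ← smul_eq_mul, ← smul_monomial]
  refine Submodule.smul_mem _ _ ?_
  have h0 : ∑ i, d (Sum.inl i) ≠ 0 := by
    intro h
    rw [weight_diffWeight] at hw
    have : ∑ j, (d (Sum.inr j) : ℤ) ≥ 0 := Finset.sum_nonneg fun _ _ => by positivity
    zify at h
    omega
  obtain ⟨i, -, hi⟩ := Finset.exists_ne_zero_of_sum_ne_zero h0
  have hle : Finsupp.single (Sum.inl i) 1 ≤ d := by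
    rw [Finsupp.single_le_iff]; omega
  obtain ⟨e, rfl⟩ := exists_add_of_le hle
  have : monomial e (1 : k) ∈ (segrePoly k n m).range := by
    refine monomial_mem_range_segrePoly _ e rfl ?_
    rw [map_add, Finsupp.weight_single] at hw
    simpa [diffWeight] using hw
  obtain ⟨g, hg⟩ := this
  refine ⟨Pi.single i g, ?_⟩
  change segrePoly k n m g = _ at hg
  simp only [LinearMap.coe_sum, Finset.sum_apply, LinearMap.coe_comp, Function.comp_apply,
    LinearMap.proj_apply, AlgHom.toLinearMap_apply, LinearMap.mulLeft_apply]
  rw [Finset.sum_eq_single i]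
  · rw [Pi.single_eq_same, hg, X, monomial_mul, one_mul]
  · intro b _ hb
    rw [Pi.single_eq_of_ne hb, map_zero, mul_zero]
  · simp

end Segre

section ConeRing

open MvPolynomial

theorem aeval_mul_left_of_isHomogeneous {k S σ : Type*} [CommRing k] [CommRing S] [Algebra k S]
    (c : S) (x : σ → S) {F : MvPolynomial σ k} {d : ℕ} (hF : F.IsHomogeneous d) :
    aeval (fun i => c * x i) F = c ^ d * aeval x F := by
  rw [F.as_sum, map_sum, map_sum, Finset.mul_sum]
  refine Finset.sum_congr rfl fun e he => ?_
  rw [aeval_monomial, aeval_monomial, mul_left_comm]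
  congr 1
  simp only [mul_pow, Finsupp.prod, Finset.prod_mul_distrib, Finset.prod_pow_eq_pow_sum]
  congr 2
  rw [← hF.degree_eq_sum_deg_support he]

theorem aeval_tmul_eq_zero {k A B σ : Type*} [CommRing k] [CommRing A] [CommRing B] [Algebra k A]
    [Algebra k B] (x : σ → A) (b : B) {F : MvPolynomial σ k} {d : ℕ} (hF : F.IsHomogeneous d)
    (h : aeval x F = 0) : aeval (fun i => x i ⊗ₜ[k] b) F = 0 := by
  have : (fun i => x i ⊗ₜ[k] b) = fun i =>
      (1 ⊗ₜ b) * Algebra.TensorProduct.includeLeft (R := k) (S := k) (B := B) (x i) := by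
    funext i
    simp
  rw [this, aeval_mul_left_of_isHomogeneous _ _ hF, ← comp_aeval_apply, h, map_zero, mul_zero]

theorem weightedHomogeneousComponent_mul {k σ : Type*} [CommRing k] (w : σ → ℤ)
    (c : MvPolynomial σ k) {f : MvPolynomial σ k} {b : ℤ} (hf : IsWeightedHomogeneous w f b)
    (a : ℤ) : weightedHomogeneousComponent w (a + b) (c * f) =
      weightedHomogeneousComponent w a c * f := by
  let := weightedGradedAlgebra k w
  have := DirectSum.coe_decompose_mul_add_of_right_mem
    (weightedHomogeneousSubmodule k w) (i := a) (a := c) hf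
  exact (weightedDecomposition.decompose'_apply k w _ _).symm.trans
    (this.trans (congrArg (· * f) (weightedDecomposition.decompose'_apply k w _ _)))

variable {k : Type u} [Field k] {n m : ℕ} (V : ProjVariety k n) (W : ProjVariety k m)

/-- The homogeneous coordinate ring of a projective variety. -/
abbrev ProjVariety.CoordRing : Type u := MvPolynomial (Fin (n + 1)) k ⧸ V.ideal.toIdeal

instance : IsDomain V.CoordRing :=
  have := V.isPrime
  Ideal.Quotient.isDomain _

/-- The homogeneous coordinates on a projective variety. -/
def ProjVariety.coord (i : Fin (n + 1)) : V.CoordRing := Ideal.Quotient.mk _ (X i)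

/-- The inclusion of the coordinate ring of the cone into the bihomogeneous coordinate ring. -/
def coneEmb : ConeRing V W →ₐ[k] V.CoordRing ⊗[k] W.CoordRing :=
  Ideal.kerLiftAlg (segreHom V.ideal.toIdeal W.ideal.toIdeal)

theorem coneEmb_injective : Function.Injective (coneEmb V W) :=
  Ideal.kerLiftAlg_injective _

/-- The coordinates `z_{ij}` on the cone. -/
def coneCoord (ij : Fin (n + 1) × Fin (m + 1)) : ConeRing V W := Ideal.Quotient.mk _ (X ij)

theorem coneEmb_mk (g : MvPolynomial (Fin (n + 1) × Fin (m + 1)) k) :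
    coneEmb V W (Ideal.Quotient.mk _ g) = segreHom V.ideal.toIdeal W.ideal.toIdeal g :=
  Ideal.kerLiftAlg_mk _ g

theorem coneEmb_coneCoord (ij : Fin (n + 1) × Fin (m + 1)) :
    coneEmb V W (coneCoord V W ij) = V.coord ij.1 ⊗ₜ W.coord ij.2 := by
  rw [coneCoord, coneEmb_mk, segreHom, aeval_X]
  rfl

/-- The linear form with coefficients `l`. -/
def linearForm (l : Fin (m + 1) → k) : MvPolynomial (Fin (m + 1)) k := ∑ j, C (l j) * X j

theorem exists_eq_linearForm {f : MvPolynomial (Fin (m + 1)) k} (hf : f.IsHomogeneous 1) :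
    ∃ l, f = linearForm l := by
  have : f ∈ homogeneousSubmodule (Fin (m + 1)) k 1 := hf
  rw [homogeneousSubmodule_one_eq_span_X, Submodule.mem_span_range_iff_exists_fun] at this
  obtain ⟨l, rfl⟩ := this
  exact ⟨l, by simp [linearForm, smul_eq_C_mul]⟩

/-- The function `∑ⱼ lⱼ z_{ij}` on the cone. -/
def coneGen (l : Fin (m + 1) → k) (i : Fin (n + 1)) : ConeRing V W :=
  Ideal.Quotient.mk _ (∑ j, C (l j) * X (i, j))

theorem segreHom_sum (I : Ideal (MvPolynomial (Fin (n + 1)) k))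
    (J : Ideal (MvPolynomial (Fin (m + 1)) k)) (l : Fin (m + 1) → k) (i : Fin (n + 1)) :
    segreHom I J (∑ j, C (l j) * X (i, j)) =
      Ideal.Quotient.mk I (X i) ⊗ₜ Ideal.Quotient.mk J (linearForm l) := by
  simp only [segreHom, linearForm, map_sum, map_mul, aeval_C, aeval_X, TensorProduct.tmul_sum]
  refine Finset.sum_congr rfl fun j _ => ?_
  rw [← Algebra.smul_def, ← TensorProduct.tmul_smul]
  congr 1
  exact Algebra.smul_def (l j) (Ideal.Quotient.mk J (X j))

theorem coneEmb_coneGen (l : Fin (m + 1) → k) (i : Fin (n + 1)) :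
    coneEmb V W (coneGen V W l i) =
      V.coord i ⊗ₜ Ideal.Quotient.mk W.ideal.toIdeal (linearForm l) := by
  rw [coneGen, coneEmb_mk, segreHom_sum]
  rfl

theorem coneGen_mul_coneCoord (l : Fin (m + 1) → k) (i i' : Fin (n + 1)) (j : Fin (m + 1)) :
    coneGen V W l i' * coneCoord V W (i, j) = coneGen V W l i * coneCoord V W (i', j) := by
  apply coneEmb_injective
  simp only [map_mul, coneEmb_coneGen, coneEmb_coneCoord, Algebra.TensorProduct.tmul_mul_tmul]
  rw [mul_comm]

theorem tmul_mem_nonZeroDivisors {A B : Type*} [CommRing A] [CommRing B] [IsDomain A] [IsDomain B]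
    [Algebra k A] [Algebra k B] {a : A} {b : B} (ha : a ≠ 0) (hb : b ≠ 0) :
    a ⊗ₜ[k] b ∈ nonZeroDivisors (A ⊗[k] B) := by
  rw [mem_nonZeroDivisors_iff_right]
  have h1 : Function.Injective (LinearMap.mulLeft k a) := mul_right_injective₀ ha
  have h2 : Function.Injective (LinearMap.mulLeft k b) := mul_right_injective₀ hb
  have h := TensorProduct.map_injective_of_flat_flat _ _ h1 h2
  have hmul (x : A ⊗[k] B) :
      TensorProduct.map (LinearMap.mulLeft k a) (LinearMap.mulLeft k b) x = x * a ⊗ₜ b := by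
    induction x using TensorProduct.induction_on with
    | zero => simp
    | tmul x y => simp [mul_comm]
    | add x y hx hy => rw [map_add, hx, hy, add_mul]
  intro x hx
  apply h
  rw [map_zero, hmul, hx]

theorem coneGen_mem_nonZeroDivisors {l : Fin (m + 1) → k} {i : Fin (n + 1)}
    (hl : linearForm l ∉ W.ideal.toIdeal) (hi : V.coord i ≠ 0) :
    coneGen V W l i ∈ nonZeroDivisors (ConeRing V W) := by
  rw [mem_nonZeroDivisors_iff_right]
  intro r hr
  apply coneEmb_injective
  rw [map_zero]
  refine (mem_nonZeroDivisors_iff_right.mp (tmul_mem_nonZeroDivisors (k := k) hi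
    (b := Ideal.Quotient.mk W.ideal.toIdeal (linearForm l)) ?_)) _ ?_
  · rwa [Ne, Ideal.Quotient.eq_zero_iff_mem]
  · rw [← coneEmb_coneGen, ← map_mul, hr, map_zero]

/-- The `coneGen` satisfy the homogeneous equations of `V`. -/
theorem aeval_coneGen_eq_zero (l : Fin (m + 1) → k) {F : MvPolynomial (Fin (n + 1)) k} {d : ℕ}
    (hF : F.IsHomogeneous d) (hFV : aeval V.coord F = 0) :
    aeval (coneGen V W l) F = 0 := by
  apply coneEmb_injective
  refine (comp_aeval_apply (B := V.CoordRing ⊗[k] W.CoordRing) (coneGen V W l)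
    (coneEmb V W) F).trans ?_
  simp only [coneEmb_coneGen, map_zero]
  exact aeval_tmul_eq_zero V.coord _ hF hFV

theorem subconeIdeal_eq_span (l : Fin (m + 1) → k) :
    subconeIdeal V W (W.ideal.toIdeal ⊔ Ideal.span {linearForm l}) =
      Ideal.span (Set.range (coneGen V W l)) := by
  apply le_antisymm
  · refine Ideal.map_le_iff_le_comap.mpr fun g hg => ?_
    have hg : segreHom V.ideal.toIdeal (W.ideal.toIdeal ⊔ Ideal.span {linearForm l}) g = 0 := hg
    rw [← toTensor_comp_segrePoly, AlgHom.comp_apply] at hg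
    have hg' : segrePoly k n m g ∈ joinIdeal V.ideal.toIdeal
        (W.ideal.toIdeal ⊔ Ideal.span {linearForm l}) := by
      rw [← ker_toTensor]; exact hg
    rw [joinIdeal, Ideal.map_sup, ← sup_assoc, Ideal.map_span, Set.image_singleton,
      Submodule.mem_sup] at hg'
    obtain ⟨u, hu, v, hv, huv⟩ := hg'
    obtain ⟨c, rfl⟩ := Ideal.mem_span_singleton'.mp hv
    let := weightedGradedAlgebra k (diffWeight n m)
    have hK : (joinIdeal V.ideal.toIdeal W.ideal.toIdeal).IsHomogeneous
        (weightedHomogeneousSubmodule k (diffWeight n m)) :=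
      Ideal.IsHomogeneous.sup
        (isHomogeneous_map_rename Sum.inl (diffWeight n m) 1 (fun _ => rfl) V.ideal.isHomogeneous)
        (isHomogeneous_map_rename Sum.inr (diffWeight n m) (-1) (fun _ => rfl) W.ideal.isHomogeneous)
    have hl : rename Sum.inr (linearForm l) ∈
        weightedHomogeneousSubmodule k (diffWeight n m) (-1) := by
      have h1 : (linearForm l).IsHomogeneous 1 :=
        IsHomogeneous.sum _ _ _ fun j _ => isHomogeneous_C_mul_X _ _
      simpa using isWeightedHomogeneous_rename Sum.inr (diffWeight n m) (-1) (fun _ => rfl) h1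
    have hu0 := weightedHomogeneousComponent_mem_of_mem k (diffWeight n m) hK hu 0
    have hs := (isWeightedHomogeneous_segrePoly g).weightedHomogeneousComponent_same
    rw [← huv, map_add, huv, show (0 : ℤ) = 1 + -1 from rfl,
      weightedHomogeneousComponent_mul _ _ hl] at hs
    obtain ⟨G, hG⟩ := exists_eq_sum_X_mul_segrePoly
      (weightedHomogeneousComponent_isWeightedHomogeneous (w := diffWeight n m) 1 c)
    have hdiff : g - ∑ i, G i * ∑ j, C (l j) * X (i, j) ∈
        segreIdeal V.ideal.toIdeal W.ideal.toIdeal := by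
      change segreHom V.ideal.toIdeal W.ideal.toIdeal _ = 0
      rw [← toTensor_comp_segrePoly, AlgHom.comp_apply]
      change _ ∈ RingHom.ker (toTensor V.ideal.toIdeal W.ideal.toIdeal)
      rw [ker_toTensor]
      convert hu0 using 1
      rw [map_sub, ← hs, hG, sub_eq_iff_eq_add, Finset.sum_mul, map_sum]
      congr 1
      refine Finset.sum_congr rfl fun i _ => ?_
      simp only [linearForm, map_sum, map_mul, segrePoly, aeval_X, aeval_C, rename_C, rename_X,
        Finset.mul_sum, algebraMap_eq]
      refine Finset.sum_congr rfl fun j _ => ?_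
      ring
    rw [Ideal.mem_comap, Ideal.Quotient.eq.mpr hdiff, map_sum]
    refine Ideal.sum_mem _ fun i _ => ?_
    rw [map_mul]
    exact Ideal.mul_mem_left _ _ (Ideal.subset_span ⟨i, rfl⟩)
  · rw [Ideal.span_le]
    rintro _ ⟨i, rfl⟩
    refine Ideal.mem_map_of_mem _ ?_
    change segreHom V.ideal.toIdeal (W.ideal.toIdeal ⊔ Ideal.span {linearForm l}) _ = 0
    rw [segreHom_sum, Ideal.Quotient.eq_zero_iff_mem.mpr
      (Ideal.mem_sup_right (Ideal.mem_span_singleton_self (linearForm l))),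
      TensorProduct.tmul_zero]

end ConeRing

/-! ### The leading form homomorphism on a Rees algebra -/

section LeadingForm

open Polynomial DirectSum

variable {k R A : Type u} [Field k] [CommRing R] [CommRing A] [Algebra k R] [Algebra k A]
  (𝒜 : ℕ → Submodule k A) [GradedAlgebra 𝒜]

theorem coe_decompose_mul_add_of_vanish {i j : ℕ} {a b : A}
    (ha : ∀ e < i, (decompose 𝒜 a e : A) = 0) (hb : ∀ e < j, (decompose 𝒜 b e : A) = 0) :
    (decompose 𝒜 (a * b) (i + j) : A) = decompose 𝒜 a i * decompose 𝒜 b j := by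
  classical
  conv_lhs => rw [← sum_support_decompose 𝒜 a, Finset.sum_mul]
  rw [decompose_sum, DFinsupp.finsetSum_apply, AddSubmonoidClass.coe_finsetSum]
  have key (e : ℕ) (he : e ≠ i) :
      (decompose 𝒜 ((decompose 𝒜 a e : A) * b) (i + j) : A) = 0 := by
    rw [coe_decompose_mul_of_left_mem 𝒜 (i + j) (SetLike.coe_mem _)]
    split_ifs with h
    · rcases lt_or_gt_of_ne he with h' | h'
      · rw [ha e h', zero_mul]
      · rw [hb _ (by omega), mul_zero]
    · rfl
  rw [Finset.sum_eq_single i (fun e _ he => key e he)]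
  · rw [coe_decompose_mul_add_of_left_mem 𝒜 (SetLike.coe_mem _)]
  · intro hi
    rw [DFinsupp.notMem_support_iff.mp hi]
    simp

theorem coe_decompose_mul_eq_zero_of_vanish {i j : ℕ} {a b : A}
    (ha : ∀ e < i, (decompose 𝒜 a e : A) = 0) (hb : ∀ e < j, (decompose 𝒜 b e : A) = 0) {e : ℕ}
    (he : e < i + j) : (decompose 𝒜 (a * b) e : A) = 0 := by
  rcases lt_or_ge e i with h | h
  · rw [← add_zero e, coe_decompose_mul_add_of_vanish 𝒜 (i := e) (j := 0)
      (fun e' he' => ha e' (he'.trans h)) (fun _ h => absurd h (by omega)), ha e h, zero_mul]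
  · obtain ⟨f, rfl⟩ := Nat.exists_eq_add_of_le h
    rw [coe_decompose_mul_add_of_vanish 𝒜 (i := i) (j := f) ha
      (fun e' he' => hb e' (by omega)), hb f (by omega), mul_zero]

theorem coe_decompose_eq_zero_of_mem_pow {d : ℕ} {a : A}
    (ha : a ∈ (HomogeneousIdeal.irrelevant 𝒜).toIdeal ^ d) {e : ℕ} (he : e < d) :
    (decompose 𝒜 a e : A) = 0 := by
  induction d generalizing a e with
  | zero => omega
  | succ d ih =>
    rw [pow_succ] at ha
    induction ha using Submodule.mul_induction_on' with
    | mem_mul_mem a ha b hb =>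
      refine coe_decompose_mul_eq_zero_of_vanish 𝒜 (i := d) (j := 1) (fun e he => ih ha he) ?_ he
      intro e' he'
      obtain rfl : e' = 0 := by omega
      exact hb
    | add a _ b _ ha hb => rw [decompose_add, DirectSum.add_apply, Submodule.coe_add, ha, hb, add_zero]

variable (ψ : R →ₐ[k] A) (Q : Ideal R)

theorem coe_decompose_map_eq_zero (hQ : ∀ r ∈ Q, ψ r ∈ (HomogeneousIdeal.irrelevant 𝒜).toIdeal)
    {d : ℕ} {r : R} (hr : r ∈ Q ^ d) {e : ℕ} (he : e < d) : (decompose 𝒜 (ψ r) e : A) = 0 := by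
  refine coe_decompose_eq_zero_of_mem_pow 𝒜 ?_ he
  have h1 : Q ≤ (HomogeneousIdeal.irrelevant 𝒜).toIdeal.comap ψ := hQ
  exact Ideal.le_comap_pow _ d (Ideal.pow_right_mono h1 d hr)

/-- The linear map `R[t] → A` that sends `r tᵈ` to the component of degree `d` of `ψ r`. -/
def leadingFormAux : R[X] →ₗ[k] A :=
  lsum fun d => GradedAlgebra.proj 𝒜 d ∘ₗ ψ.toLinearMap

theorem leadingFormAux_monomial (d : ℕ) (r : R) :
    leadingFormAux 𝒜 ψ (monomial d r) = decompose 𝒜 (ψ r) d := by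
  rw [leadingFormAux, lsum_apply, sum_monomial_index _ _ (by simp)]
  rfl

theorem leadingFormAux_mul (hQ : ∀ r ∈ Q, ψ r ∈ (HomogeneousIdeal.irrelevant 𝒜).toIdeal)
    (f g : reesAlgebra Q) :
    leadingFormAux 𝒜 ψ (f * g : R[X]) = leadingFormAux 𝒜 ψ f * leadingFormAux 𝒜 ψ g := by
  conv_rhs => rw [(f : R[X]).as_sum_support, (g : R[X]).as_sum_support]
  conv_lhs => rw [(f : R[X]).as_sum_support, (g : R[X]).as_sum_support]
  rw [Finset.sum_mul_sum, map_sum, map_sum, map_sum, Finset.sum_mul_sum]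
  refine Finset.sum_congr rfl fun i _ => ?_
  rw [map_sum]
  refine Finset.sum_congr rfl fun j _ => ?_
  rw [monomial_mul_monomial]
  simp only [leadingFormAux_monomial, map_mul]
  exact coe_decompose_mul_add_of_vanish 𝒜
    (fun e he => coe_decompose_map_eq_zero 𝒜 ψ Q hQ (f.2 i) he)
    (fun e he => coe_decompose_map_eq_zero 𝒜 ψ Q hQ (g.2 j) he)

/-- The graded homomorphism from the Rees algebra of `Q` to `A` that sends `r tᵈ` to the
component of degree `d` of `ψ r`, where `ψ : R → A` maps `Q` into the irrelevant ideal. -/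
def leadingForm (hQ : ∀ r ∈ Q, ψ r ∈ (HomogeneousIdeal.irrelevant 𝒜).toIdeal) :
    reesGrading Q →+*ᵍ 𝒜 where
  toFun f := leadingFormAux 𝒜 ψ f
  map_zero' := by simp
  map_add' f g := by simp
  map_one' := by
    change leadingFormAux 𝒜 ψ (1 : R[X]) = 1
    rw [← monomial_zero_one, leadingFormAux_monomial, map_one,
      decompose_of_mem_same 𝒜 SetLike.GradedOne.one_mem]
  map_mul' f g := leadingFormAux_mul 𝒜 ψ Q hQ f g
  map_mem := by
    rintro d f ⟨r, hr⟩
    change leadingFormAux 𝒜 ψ f ∈ _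
    have hr : monomial d r = (f : R[X]) := hr
    rw [← hr, leadingFormAux_monomial]
    exact SetLike.coe_mem _

theorem leadingForm_apply (hQ : ∀ r ∈ Q, ψ r ∈ (HomogeneousIdeal.irrelevant 𝒜).toIdeal)
    {d : ℕ} {f : reesAlgebra Q} {r : R} (h : monomial d r = (f : R[X])) :
    leadingForm 𝒜 ψ Q hQ f = decompose 𝒜 (ψ r) d := by
  change leadingFormAux 𝒜 ψ f = _
  rw [← h, leadingFormAux_monomial]

theorem exists_sub_aeval_mem {σ : Type*} [Finite σ] (q : σ → R) (𝔪 : Ideal R) (ε : R → k)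
    (hε : ∀ r, r - algebraMap k R (ε r) ∈ 𝔪) (hQ : Q = Ideal.span (Set.range q)) (d : ℕ) {s : R}
    (hs : s ∈ Q ^ d) :
    ∃ F : MvPolynomial σ k, F.IsHomogeneous d ∧ s - MvPolynomial.aeval q F ∈ 𝔪 * Q ^ d := by
  cases nonempty_fintype σ
  induction d generalizing s with
  | zero =>
    refine ⟨MvPolynomial.C (ε s), MvPolynomial.isHomogeneous_C _ _, ?_⟩
    simpa using hε s
  | succ d ih =>
    rw [pow_succ] at hs ⊢
    induction hs using Submodule.mul_induction_on' with
    | mem_mul_mem a ha b hb =>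
      obtain ⟨F, hF, hFa⟩ := ih ha
      have hb' := hb
      rw [hQ, Ideal.mem_span_range_iff_exists_fun] at hb'
      obtain ⟨c, rfl⟩ := hb'
      have hG : (∑ i, MvPolynomial.C (ε (c i)) * MvPolynomial.X i :
          MvPolynomial σ k).IsHomogeneous 1 :=
        MvPolynomial.IsHomogeneous.sum _ _ _ fun i _ => MvPolynomial.isHomogeneous_C_mul_X _ _
      refine ⟨_, hF.mul hG, ?_⟩
      have h1 : MvPolynomial.aeval q F ∈ Q ^ d := by
        rw [← sub_sub_cancel a (MvPolynomial.aeval q F)]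
        exact Ideal.sub_mem _ ha (Ideal.mul_le_right hFa)
      have h2 : a * ∑ i, c i * q i - MvPolynomial.aeval q (F *
          ∑ i, MvPolynomial.C (ε (c i)) * MvPolynomial.X i) =
          (a - MvPolynomial.aeval q F) * ∑ i, c i * q i +
            ∑ i, (c i - algebraMap k R (ε (c i))) * (MvPolynomial.aeval q F * q i) := by
        have h3 : ∑ i, (c i - algebraMap k R (ε (c i))) * (MvPolynomial.aeval q F * q i) =
            MvPolynomial.aeval q F * (∑ i, c i * q i - ∑ i, algebraMap k R (ε (c i)) * q i) := by
          rw [← Finset.sum_sub_distrib, Finset.mul_sum]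
          refine Finset.sum_congr rfl fun i _ => ?_
          ring
        rw [h3]
        simp only [map_mul, map_sum, MvPolynomial.aeval_C, MvPolynomial.aeval_X]
        ring
      rw [h2]
      refine Ideal.add_mem _ ?_ (Ideal.sum_mem _ fun i _ => ?_)
      · rw [← mul_assoc]
        exact Ideal.mul_mem_mul hFa hb
      · exact Ideal.mul_mem_mul (hε _)
          (Ideal.mul_mem_mul h1 (hQ ▸ Ideal.subset_span ⟨i, rfl⟩))
    | add a _ b _ ha hb =>
      obtain ⟨F, hF, hFa⟩ := ha
      obtain ⟨G, hG, hGb⟩ := hb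
      refine ⟨F + G, hF.add hG, ?_⟩
      rw [map_add, add_sub_add_comm]
      exact Ideal.add_mem _ hFa hGb

/-- The kernel of the leading form homomorphism, for an ideal generated by elements `qᵢ` that
satisfy the same homogeneous equations as their images in degree `1`. -/
theorem mem_mul_pow_of_decompose_eq_zero {σ : Type*} [Finite σ] (q : σ → R) (𝔪 : Ideal R) (ε : R → k)
    (hε : ∀ r, r - algebraMap k R (ε r) ∈ 𝔪) (hQ : Q = Ideal.span (Set.range q))
    (h𝔪 : ∀ r ∈ 𝔪, ψ r ∈ (HomogeneousIdeal.irrelevant 𝒜).toIdeal)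
    (hq : ∀ i, ψ (q i) ∈ 𝒜 1)
    (hrel : ∀ (d : ℕ) (F : MvPolynomial σ k), F.IsHomogeneous d →
      MvPolynomial.aeval (fun i => ψ (q i)) F = 0 → MvPolynomial.aeval q F = 0)
    {d : ℕ} {s : R} (hs : s ∈ Q ^ d)
    (h0 : (decompose 𝒜 (ψ s) d : A) = 0) :
    s ∈ 𝔪 * Q ^ d := by
  obtain ⟨F, hF, hFs⟩ := exists_sub_aeval_mem Q q 𝔪 ε hε hQ d hs
  have hQ' : Q ≤ (HomogeneousIdeal.irrelevant 𝒜).toIdeal.comap ψ := by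
    rw [hQ, Ideal.span_le]
    rintro _ ⟨i, rfl⟩
    change GradedRing.proj 𝒜 0 (ψ (q i)) = 0
    exact decompose_of_mem_ne 𝒜 (hq i) (by omega)
  have hm : 𝔪 ≤ (HomogeneousIdeal.irrelevant 𝒜).toIdeal.comap ψ := h𝔪
  have h1 : (decompose 𝒜 (ψ (s - MvPolynomial.aeval q F)) d : A) = 0 := by
    refine coe_decompose_eq_zero_of_mem_pow 𝒜 (d := d + 1) ?_ (Nat.lt_succ_self d)
    refine Ideal.le_comap_pow (K := (HomogeneousIdeal.irrelevant 𝒜).toIdeal) ψ (d + 1) ?_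
    rw [pow_succ']
    exact Ideal.mul_mono hm (Ideal.pow_right_mono hQ' d) hFs
  have h2 : ψ (MvPolynomial.aeval q F) ∈ 𝒜 d := by
    rw [MvPolynomial.comp_aeval_apply, F.as_sum, map_sum]
    refine Submodule.sum_mem _ fun e he => ?_
    rw [MvPolynomial.aeval_monomial, ← Algebra.smul_def]
    refine Submodule.smul_mem _ _ ?_
    rw [hF.degree_eq_sum_deg_support he]
    have := SetLike.prod_pow_mem_graded 𝒜 (fun _ => 1) (fun i => ψ (q i)) (F := e.support) e
      fun i _ => hq i
    simpa [Finsupp.prod] using this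
  have h3 : ψ (MvPolynomial.aeval q F) = 0 := by
    rw [map_sub, decompose_sub, DirectSum.sub_apply, Submodule.coe_sub, h0, zero_sub, neg_eq_zero,
      decompose_of_mem_same 𝒜 h2] at h1
    exact h1
  rw [MvPolynomial.comp_aeval_apply] at h3
  rwa [hrel d F hF h3, sub_zero] at hFs

end LeadingForm

/-! ### Charts of `Proj` over an affine base -/

section Chart

open HomogeneousLocalization

variable {R S : Type u} [CommRing R] [CommRing S] [Algebra R S]
  (𝒮 : ℕ → Submodule R S) [GradedAlgebra 𝒮]

/-- The structure homomorphism of the coordinate ring of the chart `D₊(s)`. -/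
def awayStructure (s : S) : R →+* Away 𝒮 s :=
  (fromZeroRingHom 𝒮 _).comp (algebraMap R (𝒮 0))

theorem val_awayStructure (s : S) (r : R) :
    (awayStructure 𝒮 s r).val = Localization.mk (algebraMap R S r) 1 := rfl

theorem awayι_projToSpec {s : S} {d : ℕ} (hs : s ∈ 𝒮 d) (hd : 0 < d) :
    Proj.awayι 𝒮 s hs hd ≫ projToSpec 𝒮 = Spec.map (CommRingCat.ofHom (awayStructure 𝒮 s)) := by
  rw [projToSpec, Proj.awayι_toSpecZero_assoc, ← Spec.map_comp, ← CommRingCat.ofHom_comp]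
  rfl

theorem awayStructure_mul_mk {s : S} {d : ℕ} (hs : s ∈ 𝒮 d) (n : ℕ) (r : R) (a : S)
    (ha : a ∈ 𝒮 (n • d)) :
    awayStructure 𝒮 s r * Away.mk 𝒮 hs n a ha =
      Away.mk 𝒮 hs n (r • a) (Submodule.smul_mem _ _ ha) := by
  apply HomogeneousLocalization.val_injective
  rw [val_mul, val_awayStructure, Away.val_mk, Away.val_mk, Localization.mk_mul, one_mul,
    Algebra.smul_def]

end Chart

/-! ### Blowing up a principal ideal -/

section Rees

open Polynomial HomogeneousLocalization

variable {R : Type u} [CommRing R] (Q : Ideal R)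

/-- The element `b t` of the Rees algebra. -/
def reesElem {b : R} (hb : b ∈ Q) : reesAlgebra Q :=
  ⟨monomial 1 b, reesAlgebra.monomial_mem.mpr (by simpa using hb)⟩

theorem reesElem_mem {b : R} (hb : b ∈ Q) : reesElem Q hb ∈ reesGrading Q 1 := ⟨b, rfl⟩

theorem coe_reesElem_pow {b : R} (hb : b ∈ Q) (N : ℕ) :
    ((reesElem Q hb ^ N : reesAlgebra Q) : R[X]) = monomial N (b ^ N) := by
  rw [SubmonoidClass.coe_pow, reesElem, monomial_pow, one_mul]

theorem coe_algebraMap_mul (r : R) (f : reesAlgebra Q) :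
    ((algebraMap R (reesAlgebra Q) r * f : reesAlgebra Q) : R[X]) = C r * f := rfl

theorem irrelevant_reesGrading_le :
    (HomogeneousIdeal.irrelevant (reesGrading Q)).toIdeal ≤
      Ideal.span (Set.range fun b : Q => reesElem Q b.2) := by
  refine (HomogeneousIdeal.toIdeal_irrelevant_le _).mpr fun d hd f hf => ?_
  obtain ⟨r, hr⟩ := (mem_reesGrading Q).mp hf
  obtain ⟨d, rfl⟩ := Nat.exists_eq_succ_of_ne_zero hd.ne'
  have hrQ : r ∈ Q ^ (d + 1) := by
    have := f.2 (d + 1)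
    rwa [← hr, coeff_monomial_same] at this
  suffices h : ∀ r (hr : r ∈ Q ^ d * Q), (⟨monomial (d + 1) r,
      reesAlgebra.monomial_mem.mpr (by rwa [pow_succ])⟩ : reesAlgebra Q) ∈
      Ideal.span (Set.range fun b : Q => reesElem Q b.2) by
    have hf' : f = ⟨monomial (d + 1) r, reesAlgebra.monomial_mem.mpr hrQ⟩ := Subtype.ext hr.symm
    rw [hf']
    exact h r (by rwa [← pow_succ])
  intro r hr
  induction hr using Submodule.mul_induction_on' with
  | mem_mul_mem a ha b hb =>
    have h1 := Ideal.mul_mem_left (Ideal.span (Set.range fun b : Q => reesElem Q b.2))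
      (⟨monomial d a, reesAlgebra.monomial_mem.mpr ha⟩ : reesAlgebra Q)
      (Ideal.subset_span ⟨⟨b, hb⟩, rfl⟩)
    convert h1 using 1
    exact Subtype.ext (monomial_mul_monomial d 1 a b).symm
  | add a ha b hb iha ihb =>
    convert Ideal.add_mem _ iha ihb using 1
    exact Subtype.ext (map_add _ a b)

variable {Q}

theorem awayStructure_injective {a : R} (ha : a ∈ Q) (ha' : a ∈ nonZeroDivisors R) :
    Function.Injective (awayStructure (reesGrading Q) (reesElem Q ha)) := by
  rw [injective_iff_map_eq_zero]
  intro r hr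
  have h1 := congrArg HomogeneousLocalization.val hr
  rw [val_awayStructure, HomogeneousLocalization.val_zero, ← Localization.mk_zero 1,
    Localization.mk_eq_mk_iff, Localization.r_iff_exists] at h1
  obtain ⟨⟨_, N, rfl⟩, hN⟩ := h1
  have h2 : reesElem Q ha ^ N * algebraMap R (reesAlgebra Q) r = 0 := by
    simpa using hN
  have h3 := congrArg (fun f : reesAlgebra Q => (f : R[X]).coeff N) h2
  simp only [mul_comm _ (algebraMap R (reesAlgebra Q) r), coe_algebraMap_mul,
    coe_reesElem_pow] at h3
  simp only [coeff_C_mul, coeff_monomial_same, ZeroMemClass.coe_zero, coeff_zero] at h3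
  exact (mul_right_mem_nonZeroDivisors_eq_zero_iff (pow_mem ha' N)).mp h3

theorem exists_awayStructure_eq {a z : R} (ha : a ∈ Q) (hz : ∀ r ∈ Q, z * r ∈ Ideal.span {a})
    (c : Away (reesGrading Q) (reesElem Q ha)) :
    ∃ b N, awayStructure (reesGrading Q) (reesElem Q ha) b =
      awayStructure (reesGrading Q) (reesElem Q ha) z ^ N * c := by
  obtain ⟨N, s, hs, rfl⟩ := Away.mk_surjective (reesGrading Q) (reesElem_mem Q ha) c
  obtain ⟨r, hr⟩ := (mem_reesGrading Q).mp hs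
  rw [smul_eq_mul, mul_one] at hr
  have hrQ : r ∈ Q ^ N := by
    have := s.2 N
    rwa [← hr, coeff_monomial_same] at this
  have h1 : z ^ N * r ∈ Ideal.span {a ^ N} := by
    rw [← Ideal.span_singleton_pow]
    have h2 : Ideal.span {z} * Q ≤ Ideal.span {a} := by
      rw [Ideal.span_singleton_mul_le_iff]
      exact hz
    refine Ideal.pow_right_mono h2 N ?_
    rw [mul_pow, Ideal.span_singleton_pow]
    exact Ideal.mul_mem_mul (Ideal.mem_span_singleton_self _) hrQ
  obtain ⟨b, hb⟩ := Ideal.mem_span_singleton'.mp h1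
  refine ⟨b, N, ?_⟩
  rw [← map_pow, awayStructure_mul_mk]
  apply HomogeneousLocalization.val_injective
  rw [val_awayStructure, Away.val_mk, Localization.mk_eq_mk_iff, Localization.r_iff_exists]
  refine ⟨1, ?_⟩
  simp only [OneMemClass.coe_one, one_mul]
  apply Subtype.ext
  rw [mul_comm, coe_algebraMap_mul, coe_reesElem_pow]
  change C b * monomial N (a ^ N) = z ^ N • (s : R[X])
  rw [← hr, C_mul_monomial, hb, smul_monomial, smul_eq_mul]

theorem preimage_basicOpen_le {a z : R} (ha : a ∈ Q) (hz : ∀ r ∈ Q, z * r ∈ Ideal.span {a}) :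
    affineBlowupMap Q ⁻¹ᵁ PrimeSpectrum.basicOpen z ≤
      Proj.basicOpen (reesGrading Q) (reesElem Q ha) := by
  intro x hx
  obtain ⟨b, hb⟩ := TopologicalSpace.Opens.mem_iSup.mp
    ((Proj.iSup_basicOpen_eq_top (reesGrading Q) _ (irrelevant_reesGrading_le Q)).ge
      (Set.mem_univ x))
  rw [← Proj.opensRange_awayι _ _ (reesElem_mem Q b.2) one_pos] at hb
  obtain ⟨y, rfl⟩ := hb
  suffices h : y ∈ Proj.awayι (reesGrading Q) _ (reesElem_mem Q b.2) one_pos ⁻¹ᵁ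
      Proj.basicOpen (reesGrading Q) (reesElem Q ha) from h
  rw [Proj.awayι_preimage_basicOpen _ (reesElem_mem Q b.2) one_pos (reesElem_mem Q ha) one_pos]
  have h1 : y ∈ (Proj.awayι _ _ (reesElem_mem Q b.2) one_pos ≫ projToSpec (reesGrading Q)) ⁻¹ᵁ
    PrimeSpectrum.basicOpen z := hx
  rw [awayι_projToSpec] at h1
  have h2 : awayStructure (reesGrading Q) (reesElem Q b.2) z ∉ y.asIdeal := h1
  change _ ∉ y.asIdeal
  intro h3
  apply h2
  obtain ⟨c, hc⟩ := Ideal.mem_span_singleton'.mp (hz b b.2)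
  have h4 : awayStructure (reesGrading Q) (reesElem Q b.2) z =
      awayStructure (reesGrading Q) (reesElem Q b.2) c *
        Away.isLocalizationElem (reesElem_mem Q b.2) (reesElem_mem Q ha) := by
    rw [awayStructure_mul_mk]
    apply HomogeneousLocalization.val_injective
    rw [val_awayStructure, Away.val_mk, Localization.mk_eq_mk_iff, Localization.r_iff_exists]
    refine ⟨1, ?_⟩
    simp only [OneMemClass.coe_one, one_mul, pow_one]
    apply Subtype.ext
    rw [mul_comm, coe_algebraMap_mul]
    change C z * monomial 1 (b : R) = c • monomial 1 a
    rw [C_mul_monomial, smul_monomial, smul_eq_mul, hc]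
  rw [h4]
  exact Ideal.mul_mem_left _ _ h3

theorem isIso_SpecMap_restrict_basicOpen {R C : Type u} [CommRing R] [CommRing C] (ρ : R →+* C)
    (z : R) (h : Function.Bijective (Localization.awayMap ρ z)) :
    IsIso (Spec.map (CommRingCat.ofHom ρ) ∣_ PrimeSpectrum.basicOpen z) := by
  refine ((MorphismProperty.isomorphisms Scheme).arrow_mk_iso_iff
    (SpecMapRestrictBasicOpenIso (CommRingCat.ofHom ρ) z)).mpr ?_
  have : IsIso (CommRingCat.ofHom (Localization.awayMap ρ z)) :=
    (ConcreteCategory.isIso_iff_bijective _).mpr h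
  exact inferInstanceAs (IsIso (Spec.map (CommRingCat.ofHom (Localization.awayMap ρ z))))

theorem isIso_restrict_of_isIso_comp_restrict {X Y Z : Scheme.{u}} (ι : X ⟶ Y) [IsOpenImmersion ι]
    (f : Y ⟶ Z) (U : Z.Opens) (hU : f ⁻¹ᵁ U ≤ ι.opensRange) (h : IsIso ((ι ≫ f) ∣_ U)) :
    IsIso (f ∣_ U) := by
  rw [morphismRestrict_comp] at h
  have : Surjective (ι ∣_ (f ⁻¹ᵁ U)) := by
    refine ⟨fun x => ?_⟩
    obtain ⟨y, hy⟩ := hU x.2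
    refine ⟨⟨y, ?_⟩, ?_⟩
    · change ι y ∈ f ⁻¹ᵁ U
      exact hy ▸ x.2
    · exact Subtype.ext ((morphismRestrict_base_coe ι _ _).trans hy)
  have : IsIso (ι ∣_ (f ⁻¹ᵁ U)) :=
    (isIso_iff_isOpenImmersion_and_surjective _).mpr ⟨inferInstance, this⟩
  exact @IsIso.of_isIso_comp_left _ _ _ _ _ (ι ∣_ (f ⁻¹ᵁ U)) (f ∣_ U) this h

/-- The blowing up along `Q` is an isomorphism over `D(z)` if `z Q` is contained in the ideal
generated by a regular element of `Q`. -/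
theorem isIso_affineBlowupMap_restrict {a z : R} (ha : a ∈ Q) (ha' : a ∈ nonZeroDivisors R)
    (hz : ∀ r ∈ Q, z * r ∈ Ideal.span {a}) :
    IsIso (affineBlowupMap Q ∣_ PrimeSpectrum.basicOpen z) := by
  let ι : Spec (.of (Away (reesGrading Q) (reesElem Q ha))) ⟶ affineBlowup Q :=
    Proj.awayι (reesGrading Q) _ (reesElem_mem Q ha) one_pos
  have hι : ι ≫ affineBlowupMap Q =
      Spec.map (CommRingCat.ofHom (awayStructure (reesGrading Q) (reesElem Q ha))) :=
    awayι_projToSpec (reesGrading Q) (reesElem_mem Q ha) one_pos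
  have : IsOpenImmersion ι := inferInstanceAs (IsOpenImmersion (Proj.awayι _ _ _ _))
  have h1 : IsIso ((ι ≫ affineBlowupMap Q) ∣_ PrimeSpectrum.basicOpen z) := by
    rw [hι]
    refine isIso_SpecMap_restrict_basicOpen _ z
      ⟨Localization.awayMap_injective_iff.mpr fun r hr => ⟨0, ?_⟩,
        Localization.awayMap_surjective_iff.mpr fun c => exists_awayStructure_eq ha hz c⟩
    rw [(injective_iff_map_eq_zero _).mp (awayStructure_injective ha ha') r hr, mul_zero]
  refine isIso_restrict_of_isIso_comp_restrict ι _ _ ?_ h1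
  exact (preimage_basicOpen_le ha hz).trans
    (Proj.opensRange_awayι (reesGrading Q) _ (reesElem_mem Q ha) one_pos).ge

end Rees

/-! ### Closed subschemes of `Proj` and fibers -/

section ClosedImmersion

open HomogeneousLocalization

theorem isClosedImmersion_restrict_of_charts {X Y X' Y' : Scheme.{u}} (f : X ⟶ Y) (U : Y.Opens)
    (j : X' ⟶ X) (j' : Y' ⟶ Y) [IsOpenImmersion j] [IsOpenImmersion j'] (c : X' ⟶ Y')
    [IsClosedImmersion c] (hj : j.opensRange = f ⁻¹ᵁ U) (hj' : j'.opensRange = U)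
    (h : j ≫ f = c ≫ j') : IsClosedImmersion (f ∣_ U) := by
  let e := IsOpenImmersion.isoOfRangeEq j (f ⁻¹ᵁ U).ι
    (by rw [Scheme.Opens.range_ι, ← hj]; rfl)
  let e' := IsOpenImmersion.isoOfRangeEq j' U.ι (by rw [Scheme.Opens.range_ι, ← hj']; rfl)
  have h1 : f ∣_ U = e.inv ≫ c ≫ e'.hom := by
    rw [← cancel_mono U.ι, morphismRestrict_ι, Category.assoc, Iso.eq_inv_comp]
    simp [e, e', h]
  rw [h1]
  infer_instance

theorem toSpecΓ_comp_map_injective {X : Scheme.{u}} (U : X.Opens) {R : CommRingCat.{u}}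
    {a b : R ⟶ Γ(X, U)} (h : U.toSpecΓ ≫ Spec.map a = U.toSpecΓ ≫ Spec.map b) : a = b := by
  have h2 := congrArg Scheme.Hom.appTop h
  rw [Scheme.Hom.comp_appTop, Scheme.Hom.comp_appTop, Scheme.Opens.toSpecΓ_appTop,
    Scheme.ΓSpecIso_naturality_assoc, Scheme.ΓSpecIso_naturality_assoc] at h2
  exact (cancel_mono U.topIso.inv).mp ((cancel_epi (Scheme.ΓSpecIso R).hom).mp h2)

theorem eq_of_ι_comp_eq {X : Scheme.{u}} {R : CommRingCat.{u}}
    (p : X ⟶ Spec R) (U : X.Opens) (θ : R ⟶ Γ(X, U))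
    (hθ : U.ι ≫ p = U.toSpecΓ ≫ Spec.map θ) :
    θ = (Scheme.ΓSpecIso R).inv ≫ p.appTop ≫ X.presheaf.map (homOfLE le_top : U ⟶ ⊤).op := by
  apply toSpecΓ_comp_map_injective
  rw [← hθ, Spec.map_comp, Spec.map_comp, Category.assoc,
    Scheme.Opens.toSpecΓ_SpecMap_presheaf_map_top_assoc, ← Scheme.toSpecΓ_naturality_assoc,
    toSpecΓ_SpecMap_ΓSpecIso_inv, Category.comp_id]

theorem comp_app_eq_of_ι_comp_eq {T X : Scheme.{u}} {R : CommRingCat.{u}} (g : T ⟶ X)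
    (p : X ⟶ Spec R) (U : X.Opens) (θ : R ⟶ Γ(X, U))
    (hθ : U.ι ≫ p = U.toSpecΓ ≫ Spec.map θ) :
    θ ≫ g.app U = (Scheme.ΓSpecIso R).inv ≫ (g ≫ p).appTop ≫
      T.presheaf.map (homOfLE le_top : g ⁻¹ᵁ U ⟶ ⊤).op := by
  apply eq_of_ι_comp_eq
  rw [← morphismRestrict_ι_assoc, hθ, Spec.map_comp, Scheme.Opens.toSpecΓ_naturality_assoc]

section Surjective

variable {S A σ τ : Type u} [CommRing S] [CommRing A] [SetLike σ S] [AddSubgroupClass σ S]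
  [SetLike τ A] [AddSubgroupClass τ A] {𝒮 : ℕ → σ} {𝒜 : ℕ → τ} [GradedRing 𝒮] [GradedRing 𝒜]
  (φ : 𝒮 →+*ᵍ 𝒜)

theorem exists_mem_of_surjective (hφ : Function.Surjective φ) {d : ℕ} {a : A} (ha : a ∈ 𝒜 d) :
    ∃ s ∈ 𝒮 d, φ s = a := by
  obtain ⟨s, rfl⟩ := hφ a
  refine ⟨DirectSum.decompose 𝒮 s d, SetLike.coe_mem _, ?_⟩
  rw [GradedRingHom.map_directSumDecompose, DirectSum.decompose_of_mem_same 𝒜 ha]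

theorem irrelevant_le_map_of_surjective (hφ : Function.Surjective φ) :
    HomogeneousIdeal.irrelevant 𝒜 ≤ (HomogeneousIdeal.irrelevant 𝒮).map φ := by
  refine (HomogeneousIdeal.toIdeal_irrelevant_le _).mpr fun d hd a ha => ?_
  obtain ⟨s, hs, rfl⟩ := exists_mem_of_surjective φ hφ ha
  exact Ideal.mem_map_of_mem _ (HomogeneousIdeal.mem_irrelevant_of_mem 𝒮 hd hs)

theorem awayMap_surjective (hφ : Function.Surjective φ) {s : S} {d : ℕ} (hs : s ∈ 𝒮 d) :
    Function.Surjective (Away.map φ s) := by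
  intro y
  obtain ⟨N, a, ha, rfl⟩ := Away.mk_surjective 𝒜 (φ.2 hs) y
  obtain ⟨b, hb, rfl⟩ := exists_mem_of_surjective φ hφ ha
  exact ⟨Away.mk 𝒮 hs N b hb, Away.map_mk ..⟩

theorem projMap_app_awayToSection (h : HomogeneousIdeal.irrelevant 𝒜 ≤
    (HomogeneousIdeal.irrelevant 𝒮).map φ) {s : S} {d : ℕ} (hs : s ∈ 𝒮 d) (y : Away 𝒮 s) :
    (Proj.map φ h).app (Proj.basicOpen 𝒮 s) (Proj.awayToSection 𝒮 s y) =
      Proj.awayToSection 𝒜 (φ s) (Away.map φ s y) := by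
  rw [Scheme.Hom.app_eq_appLE]
  exact congrArg (fun f => f.hom y) (Proj.awayToSection_comp_appLE φ h hs)

theorem iSup_basicOpen_homogeneous :
    ⨆ s : Σ i : ℕ+, 𝒮 i, Proj.basicOpen 𝒮 (s.2 : S) = ⊤ :=
  Proj.iSup_basicOpen_eq_top 𝒮 _ ((HomogeneousIdeal.toIdeal_irrelevant_le _).mpr
    fun d hd x hx => Ideal.subset_span ⟨⟨⟨d, hd⟩, ⟨x, hx⟩⟩, rfl⟩)

theorem isClosedImmersion_projMap (h : HomogeneousIdeal.irrelevant 𝒜 ≤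
    (HomogeneousIdeal.irrelevant 𝒮).map φ) (hφ : Function.Surjective φ) :
    IsClosedImmersion (Proj.map φ h) := by
  refine (IsZariskiLocalAtTarget.iff_of_iSup_eq_top (P := @IsClosedImmersion) _
    (iSup_basicOpen_homogeneous (𝒮 := 𝒮))).mpr ?_
  rintro ⟨i, s⟩
  have : IsClosedImmersion (Spec.map (CommRingCat.ofHom (Away.map φ (s : S)))) :=
    IsClosedImmersion.spec_of_surjective _ (awayMap_surjective φ hφ s.2)
  have : IsOpenImmersion (Proj.awayι 𝒜 (φ (s : S)) (φ.2 s.2) i.2) :=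
    inferInstanceAs (IsOpenImmersion (_ ≫ _))
  have : IsOpenImmersion (Proj.awayι 𝒮 (s : S) s.2 i.2) :=
    inferInstanceAs (IsOpenImmersion (_ ≫ _))
  exact isClosedImmersion_restrict_of_charts _ _ (Proj.awayι 𝒜 (φ (s : S)) (φ.2 s.2) i.2)
    (Proj.awayι 𝒮 (s : S) s.2 i.2) _ (Proj.opensRange_awayι ..) (Proj.opensRange_awayι ..)
    (Proj.awayι_comp_map φ h i.2 s s.2)

end Surjective

section Fiber

variable {R S : Type u} [CommRing R] [CommRing S] [Algebra R S]
  (𝒮 : ℕ → Submodule R S) [GradedAlgebra 𝒮]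
  {A τ : Type u} [CommRing A] [SetLike τ A] [AddSubgroupClass τ A] {𝒜 : ℕ → τ} [GradedRing 𝒜]

theorem away_mk_mem_map_of_mem_smul {s : S} {d : ℕ} (hs : s ∈ 𝒮 d) (N : ℕ) {a : S}
    (ha : a ∈ 𝒮 (N • d)) {𝔪 : Ideal R} (h : a ∈ 𝔪 • 𝒮 (N • d)) :
    Away.mk 𝒮 hs N a ha ∈ 𝔪.map (awayStructure 𝒮 s) := by
  suffices ∃ ha', Away.mk 𝒮 hs N a ha' ∈ 𝔪.map (awayStructure 𝒮 s) from this.2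
  refine Submodule.smul_induction_on h (fun r hr b hb => ⟨Submodule.smul_mem _ _ hb, ?_⟩) ?_
  · rw [← awayStructure_mul_mk 𝒮 hs N r b hb]
    exact Ideal.mul_mem_right _ _ (Ideal.mem_map_of_mem _ hr)
  · rintro a b ⟨ha, ha'⟩ ⟨hb, hb'⟩
    refine ⟨add_mem ha hb, ?_⟩
    convert Ideal.add_mem _ ha' hb' using 1
    apply HomogeneousLocalization.val_injective
    simp [Away.val_mk, Localization.add_mk_self]

theorem mem_map_of_awayMap_eq_zero (φ : 𝒮 →+*ᵍ 𝒜) {𝔪 : Ideal R}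
    (hker : ∀ d, ∀ s ∈ 𝒮 d, φ s = 0 → s ∈ 𝔪 • 𝒮 d) {s : S} {d : ℕ} (hs : s ∈ 𝒮 d)
    {y : Away 𝒮 s} (hy : Away.map φ s y = 0) : y ∈ 𝔪.map (awayStructure 𝒮 s) := by
  obtain ⟨N, a, ha, rfl⟩ := Away.mk_surjective 𝒮 hs y
  rw [Away.map_mk] at hy
  have h1 := congrArg HomogeneousLocalization.val hy
  rw [Away.val_mk, HomogeneousLocalization.val_zero, ← Localization.mk_zero 1,
    Localization.mk_eq_mk_iff, Localization.r_iff_exists] at h1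
  obtain ⟨⟨_, M, rfl⟩, hM⟩ := h1
  have h2 : φ (s ^ M * a) = 0 := by
    simpa using hM
  have h3 : s ^ M * a ∈ 𝒮 ((M + N) • d) := by
    rw [add_smul]
    exact SetLike.mul_mem_graded (SetLike.pow_mem_graded M hs) ha
  have h4 := away_mk_mem_map_of_mem_smul 𝒮 hs (M + N) h3 (hker _ _ h3 h2)
  convert h4 using 1
  apply HomogeneousLocalization.val_injective
  rw [Away.val_mk, Away.val_mk, Localization.mk_eq_mk_iff, Localization.r_iff_exists]
  refine ⟨1, ?_⟩
  simp only [OneMemClass.coe_one, one_mul, pow_add]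
  ring

theorem app_awayToSection_awayStructure {T : Scheme.{u}} (g : T ⟶ Proj 𝒮) {s : S} {d : ℕ}
    (hs : s ∈ 𝒮 d) (hd : 0 < d) {r : R}
    (hr : (g ≫ projToSpec 𝒮).appTop ((Scheme.ΓSpecIso (.of R)).inv r) = 0) :
    g.app (Proj.basicOpen 𝒮 s) (Proj.awayToSection 𝒮 s (awayStructure 𝒮 s r)) = 0 := by
  have h1 := comp_app_eq_of_ι_comp_eq g (projToSpec 𝒮) (Proj.basicOpen 𝒮 s)
    (CommRingCat.ofHom (awayStructure 𝒮 s) ≫ Proj.awayToSection 𝒮 s) (by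
      have h2 := congrArg ((Proj.basicOpenIsoSpec 𝒮 s hs hd).hom ≫ ·) (awayι_projToSpec 𝒮 hs hd)
      rw [Proj.awayι] at h2
      simp only [Category.assoc, Iso.hom_inv_id_assoc] at h2
      rw [h2, Spec.map_comp, Proj.basicOpenIsoSpec_hom, Proj.basicOpenToSpec, Category.assoc])
  have h2 := congrArg (fun f => f.hom r) h1
  refine h2.trans ?_
  change (T.presheaf.map _) ((g ≫ projToSpec 𝒮).appTop ((Scheme.ΓSpecIso (.of R)).inv r)) = 0
  rw [hr, map_zero]

theorem ker_projMap_le_ker (φ : 𝒮 →+*ᵍ 𝒜) (h : HomogeneousIdeal.irrelevant 𝒜 ≤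
    (HomogeneousIdeal.irrelevant 𝒮).map φ) {𝔪 : Ideal R}
    (hφ : Function.Surjective φ)
    (hker : ∀ d, ∀ s ∈ 𝒮 d, φ s = 0 → s ∈ 𝔪 • 𝒮 d) {T : Scheme.{u}} (g : T ⟶ Proj 𝒮)
    [QuasiCompact g]
    (hg : ∀ r ∈ 𝔪, (g ≫ projToSpec 𝒮).appTop ((Scheme.ΓSpecIso (.of R)).inv r) = 0) :
    (Proj.map φ h).ker ≤ g.ker := by
  have := isClosedImmersion_projMap φ h hφ
  refine Scheme.IdealSheafData.le_of_iSup_eq_top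
    (fun s : Σ i : ℕ+, 𝒮 i => ⟨Proj.basicOpen 𝒮 (s.2 : S),
      Proj.isAffineOpen_basicOpen 𝒮 _ s.2.2 s.1.2⟩) iSup_basicOpen_homogeneous ?_
  rintro ⟨i, s⟩
  rw [Scheme.Hom.ker_apply, Scheme.Hom.ker_apply]
  intro y hy
  obtain ⟨y, rfl⟩ := (ConcreteCategory.bijective_of_isIso
    (Proj.basicOpenIsoAway 𝒮 (s : S) s.2 i.2).hom).2 y
  have h1 : Proj.awayToSection 𝒜 (φ (s : S)) (Away.map φ (s : S) y) = 0 :=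
    (projMap_app_awayToSection φ h s.2 y).symm.trans hy
  have h2 : Away.map φ (s : S) y = 0 :=
    (ConcreteCategory.bijective_of_isIso
      (Proj.basicOpenIsoAway 𝒜 (φ (s : S)) (φ.2 s.2) i.2).hom).1 (h1.trans (map_zero _).symm)
  have h3 : 𝔪.map (awayStructure 𝒮 (s : S)) ≤
      RingHom.ker ((g.app (Proj.basicOpen 𝒮 (s : S))).hom.comp
        (Proj.awayToSection 𝒮 (s : S)).hom) :=
    Ideal.map_le_iff_le_comap.mpr fun r hr =>
      app_awayToSection_awayStructure 𝒮 g s.2 i.2 (hg r hr)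
  exact h3 (mem_map_of_awayMap_eq_zero 𝒮 φ hker s.2 h2)

end Fiber

theorem exists_fiber_iso {X Y Z : Scheme.{u}} (f : X ⟶ Y) (y : Y) (i : Z ⟶ X)
    [IsClosedImmersion i] (t : Z ⟶ Spec (Y.residueField y))
    (ht : i ≫ f = t ≫ Y.fromSpecResidueField y) (hker : i.ker ≤ (f.fiberι y).ker) :
    ∃ e : f.fiber y ≅ Z, e.hom ≫ i = f.fiberι y := by
  let j : Z ⟶ f.fiber y := Limits.pullback.lift i t ht
  have hj : j ≫ f.fiberι y = i := Limits.pullback.lift_fst _ _ _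
  refine ⟨⟨IsClosedImmersion.lift i (f.fiberι y) hker, j, ?_, ?_⟩, ?_⟩
  · rw [← cancel_mono (f.fiberι y), Category.assoc, hj, IsClosedImmersion.lift_fac,
      Category.id_comp]
  · rw [← cancel_mono i, Category.assoc, IsClosedImmersion.lift_fac, Category.id_comp, hj]
  · exact IsClosedImmersion.lift_fac _ _ _

theorem exists_eq_comp_fromSpecResidueField {K : Type u} [Field K] {Y : Scheme.{u}}
    (g : Spec (.of K) ⟶ Y) (y : Y) (hy : g (IsLocalRing.closedPoint K) = y) :
    ∃ δ, g = δ ≫ Y.fromSpecResidueField y := by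
  subst hy
  exact ⟨_, (Scheme.descResidueField_stalkClosedPointTo_fromSpecResidueField K Y g).symm⟩

theorem fromSpecResidueField_appTop_eq_zero {R : Type u} [CommRing R] (x : Spec (.of R)) {r : R}
    (hr : r ∈ x.asIdeal) :
    ((Spec (.of R)).fromSpecResidueField x).appTop ((Scheme.ΓSpecIso (.of R)).inv r) = 0 := by
  have : x.asIdeal.IsPrime := PrimeSpectrum.isPrime x
  have h1 := Scheme.Spec.map_residueFieldIso_inv_eq_fromSpecResidueField (.of R) x
  rw [← Spec.map_comp] at h1
  have h2 := congrArg (fun f => f.appTop ((Scheme.ΓSpecIso (.of R)).inv r)) h1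
  refine h2.symm.trans ?_
  have h3 := congrArg (fun f => f.hom r) (Scheme.ΓSpecIso_inv_naturality
    ((CommRingCat.ofHom (algebraMap R x.asIdeal.ResidueField)) ≫
      (Scheme.Spec.residueFieldIso (.of R) x).inv))
  refine h3.symm.trans ?_
  have h4 : algebraMap R x.asIdeal.ResidueField r = 0 :=
    Ideal.algebraMap_residueField_eq_zero.mpr hr
  change (Scheme.ΓSpecIso _).inv ((Scheme.Spec.residueFieldIso (.of R) x).inv
    (algebraMap R x.asIdeal.ResidueField r)) = 0
  rw [h4, map_zero, map_zero]

end ClosedImmersion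

/-! ### The fiber of the blowing up over the vertex -/

section Structure

open HomogeneousLocalization

variable {R S k A : Type u} [CommRing R] [CommRing S] [Algebra R S] [CommRing k]
  [CommRing A] [Algebra k A] {𝒮 : ℕ → Submodule R S} [GradedAlgebra 𝒮]
  {𝒜 : ℕ → Submodule k A} [GradedAlgebra 𝒜]

theorem awayι_projMap_projToSpec (φ : 𝒮 →+*ᵍ 𝒜) (h : HomogeneousIdeal.irrelevant 𝒜 ≤
    (HomogeneousIdeal.irrelevant 𝒮).map φ) (ε : R →+* k)
    (hφ : ∀ r, φ (algebraMap R S r) = algebraMap k A (ε r)) {s : S} {d : ℕ} (hs : s ∈ 𝒮 d)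
    (hd : 0 < d) :
    Proj.awayι 𝒜 (φ s) (φ.2 hs) hd ≫ Proj.map φ h ≫ projToSpec 𝒮 =
      Proj.awayι 𝒜 (φ s) (φ.2 hs) hd ≫ projToSpec 𝒜 ≫ Spec.map (CommRingCat.ofHom ε) := by
  rw [← Category.assoc, Proj.awayι_comp_map φ h hd s hs, Category.assoc, awayι_projToSpec,
    ← Category.assoc, awayι_projToSpec, ← Spec.map_comp, ← Spec.map_comp,
    ← CommRingCat.ofHom_comp, ← CommRingCat.ofHom_comp]
  congr 2
  ext r
  change Localization.mk (φ (algebraMap R S r)) _ = Localization.mk (algebraMap k A (ε r)) _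
  rw [hφ]
  congr 1
  exact Subtype.ext (map_one φ)

theorem projMap_projToSpec (φ : 𝒮 →+*ᵍ 𝒜) (h : HomogeneousIdeal.irrelevant 𝒜 ≤
    (HomogeneousIdeal.irrelevant 𝒮).map φ) (ε : R →+* k)
    (hφ : ∀ r, φ (algebraMap R S r) = algebraMap k A (ε r)) :
    Proj.map φ h ≫ projToSpec 𝒮 = projToSpec 𝒜 ≫ Spec.map (CommRingCat.ofHom ε) :=
  (Proj.mapAffineOpenCover φ h).openCover.hom_ext _ _ fun s =>
    awayι_projMap_projToSpec φ h ε hφ s.2.2 s.1.2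

theorem mem_smul_reesGrading {Q 𝔪 : Ideal R} {d : ℕ} {r : R} (hr : r ∈ 𝔪 * Q ^ d)
    {s : reesAlgebra Q} (hs : Polynomial.monomial d r = (s : Polynomial R)) :
    s ∈ 𝔪 • reesGrading Q d := by
  suffices h : ∃ t ∈ 𝔪 • reesGrading Q d, (t : Polynomial R) = Polynomial.monomial d r by
    obtain ⟨t, ht, ht'⟩ := h
    rwa [Subtype.ext (hs.symm.trans ht'.symm)]
  refine Submodule.mul_induction_on hr (fun a ha b hb => ?_) ?_
  · refine ⟨a • ⟨Polynomial.monomial d b, reesAlgebra.monomial_mem.mpr hb⟩,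
      Submodule.smul_mem_smul ha ⟨b, rfl⟩, ?_⟩
    change a • Polynomial.monomial d b = _
    rw [Polynomial.smul_monomial, smul_eq_mul]
  · rintro a b ⟨s, hs, hs'⟩ ⟨t, ht, ht'⟩
    exact ⟨s + t, Submodule.add_mem _ hs ht, by rw [map_add, ← hs', ← ht']; rfl⟩

end Structure

section Slice

open MvPolynomial DirectSum

variable {k : Type u} [Field k] {n m : ℕ} (V : ProjVariety k n) (W : ProjVariety k m)

/-- The grading of the homogeneous coordinate ring of a projective variety. -/
abbrev ProjVariety.grading (d : ℕ) : Submodule k V.CoordRing :=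
  quotGrading (homogeneousSubmodule (Fin (n + 1)) k) V.ideal d

theorem ProjVariety.coord_mem (i : Fin (n + 1)) : V.coord i ∈ V.grading 1 :=
  ⟨X i, isHomogeneous_X k i, rfl⟩

theorem evalVertex_coneCoord (ij : Fin (n + 1) × Fin (m + 1)) :
    evalVertex V W (coneCoord V W ij) = 0 :=
  aeval_X (0 : Fin (n + 1) × Fin (m + 1) → k) ij

theorem sub_evalVertex_mem_span (r : ConeRing V W) :
    r - algebraMap k _ (evalVertex V W r) ∈ Ideal.span (Set.range (coneCoord V W)) := by
  obtain ⟨g, rfl⟩ := Ideal.Quotient.mk_surjective r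
  induction g using MvPolynomial.induction_on with
  | C a =>
    have : Ideal.Quotient.mk (segreIdeal V.ideal.toIdeal W.ideal.toIdeal) (C a) =
      algebraMap k _ a := rfl
    rw [this, AlgHom.commutes]
    simp
  | add f g hf hg =>
    convert Ideal.add_mem _ hf hg using 1
    simp only [map_add]
    ring
  | mul_X g ij _ =>
    have h : Ideal.Quotient.mk (segreIdeal V.ideal.toIdeal W.ideal.toIdeal) (X ij) =
      coneCoord V W ij := rfl
    rw [map_mul, h, map_mul, evalVertex_coneCoord, mul_zero, map_zero, sub_zero]
    exact Ideal.mul_mem_left _ _ (Ideal.subset_span ⟨ij, rfl⟩)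

theorem ker_evalVertex :
    RingHom.ker (evalVertex V W) = Ideal.span (Set.range (coneCoord V W)) := by
  refine le_antisymm (fun r hr => ?_) (Ideal.span_le.mpr ?_)
  · have := sub_evalVertex_mem_span V W r
    rwa [(RingHom.mem_ker.mp hr : _ = _), map_zero, sub_zero] at this
  · rintro _ ⟨ij, rfl⟩
    exact evalVertex_coneCoord V W ij

variable {W} {w : Fin (m + 1) → k}

/-- The restriction of functions on the cone `C(V × W)` to the cone over `V × {w}`, for a point
`w` of the cone over `W`. -/
def sliceHom (hw : W.ideal.toIdeal ≤ RingHom.ker (aeval w : _ →ₐ[k] k)) :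
    ConeRing V W →ₐ[k] V.CoordRing :=
  (Algebra.TensorProduct.lift (AlgHom.id k V.CoordRing)
    ((Algebra.ofId k V.CoordRing).comp (Ideal.Quotient.liftₐ _ (aeval w) hw))
    (fun _ _ => Commute.all _ _)).comp (coneEmb V W)

variable (hw : W.ideal.toIdeal ≤ RingHom.ker (aeval w : _ →ₐ[k] k))

theorem sliceHom_coneCoord (ij : Fin (n + 1) × Fin (m + 1)) :
    sliceHom V hw (coneCoord V W ij) = algebraMap k _ (w ij.2) * V.coord ij.1 := by
  rw [sliceHom, AlgHom.comp_apply, coneEmb_coneCoord, Algebra.TensorProduct.lift_tmul, mul_comm]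
  congr 1
  exact congrArg (algebraMap k V.CoordRing) (aeval_X w ij.2)

theorem sliceHom_coneGen (l : Fin (m + 1) → k) (i : Fin (n + 1)) :
    sliceHom V hw (coneGen V W l i) =
      algebraMap k _ (aeval w (linearForm l)) * V.coord i := by
  rw [sliceHom, AlgHom.comp_apply, coneEmb_coneGen, Algebra.TensorProduct.lift_tmul, mul_comm]
  rfl

theorem sliceHom_coneGen_mem (l : Fin (m + 1) → k) (i : Fin (n + 1)) :
    sliceHom V hw (coneGen V W l i) ∈ V.grading 1 := by
  rw [sliceHom_coneGen, ← Algebra.smul_def]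
  exact Submodule.smul_mem _ _ (V.coord_mem i)

theorem sliceHom_mem_irrelevant {r : ConeRing V W} (hr : r ∈ RingHom.ker (evalVertex V W)) :
    sliceHom V hw r ∈ (HomogeneousIdeal.irrelevant V.grading).toIdeal := by
  rw [ker_evalVertex] at hr
  refine (Ideal.span_le (I := (HomogeneousIdeal.irrelevant V.grading).toIdeal.comap
    (sliceHom V hw))).mpr ?_ hr
  rintro _ ⟨ij, rfl⟩
  change sliceHom V hw (coneCoord V W ij) ∈ (HomogeneousIdeal.irrelevant V.grading).toIdeal
  rw [sliceHom_coneCoord]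
  exact Ideal.mul_mem_left _ _
    (HomogeneousIdeal.mem_irrelevant_of_mem V.grading one_pos (V.coord_mem ij.1))

theorem decompose_sliceHom_zero (r : ConeRing V W) :
    (decompose V.grading (sliceHom V hw r) 0 : V.CoordRing) =
      algebraMap k _ (evalVertex V W r) := by
  have h1 : r - algebraMap k _ (evalVertex V W r) ∈ RingHom.ker (evalVertex V W) := by
    rw [ker_evalVertex]
    exact sub_evalVertex_mem_span V W r
  have h2 : GradedRing.proj V.grading 0
      (sliceHom V hw (r - algebraMap k _ (evalVertex V W r))) = 0 :=
    sliceHom_mem_irrelevant V hw h1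
  rw [map_sub, map_sub, sub_eq_zero, AlgHom.commutes] at h2
  refine h2.trans ?_
  exact decompose_of_mem_same V.grading (SetLike.algebraMap_mem_graded V.grading _)

variable (l : Fin (m + 1) → k)

theorem evalVertex_coneGen (i : Fin (n + 1)) : evalVertex V W (coneGen V W l i) = 0 := by
  change aeval (0 : Fin (n + 1) × Fin (m + 1) → k) (∑ j, C (l j) * X (i, j)) = 0
  simp

variable (W) in
/-- The ideal of the center of the blowing up. -/
abbrev centerIdeal : Ideal (ConeRing V W) := Ideal.span (Set.range (coneGen V W l))

theorem coneGen_mem_centerIdeal (i : Fin (n + 1)) : coneGen V W l i ∈ centerIdeal V W l :=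
  Ideal.subset_span ⟨i, rfl⟩

theorem centerIdeal_le : centerIdeal V W l ≤ RingHom.ker (evalVertex V W) := by
  rw [Ideal.span_le]
  rintro _ ⟨i, rfl⟩
  exact evalVertex_coneGen V l i

/-- The homomorphism from the Rees algebra to the homogeneous coordinate ring of `V` defining the
embedding of `V` in the blowing up. -/
def coneLeadingForm :
    reesGrading (centerIdeal V W l) →+*ᵍ V.grading :=
  leadingForm V.grading (sliceHom V hw) _
    fun _ hr => sliceHom_mem_irrelevant V hw (centerIdeal_le V l hr)

theorem coneLeadingForm_algebraMap (r : ConeRing V W) :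
    coneLeadingForm V hw l (algebraMap _ _ r) = algebraMap k _ (evalVertex V W r) := by
  rw [coneLeadingForm, leadingForm_apply V.grading _ _ _ (d := 0) (r := r) rfl,
    decompose_sliceHom_zero]

theorem coneLeadingForm_reesElem (i : Fin (n + 1)) :
    coneLeadingForm V hw l (reesElem _ (coneGen_mem_centerIdeal V l i)) =
      algebraMap k _ (aeval w (linearForm l)) * V.coord i := by
  rw [coneLeadingForm, leadingForm_apply V.grading _ _ _ (d := 1) (r := coneGen V W l i) rfl,
    decompose_of_mem_same V.grading (sliceHom_coneGen_mem V hw l i), sliceHom_coneGen]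

theorem coneLeadingForm_surjective (hl : aeval w (linearForm l) ≠ (0 : k)) :
    Function.Surjective (coneLeadingForm V hw l) := by
  intro a
  obtain ⟨g, rfl⟩ := Ideal.Quotient.mk_surjective a
  have hC (a : k) : coneLeadingForm V hw l (algebraMap _ _ (algebraMap k (ConeRing V W) a)) =
      algebraMap k _ a := by
    rw [coneLeadingForm_algebraMap, AlgHom.commutes]
    rfl
  induction g using MvPolynomial.induction_on with
  | C a => exact ⟨_, hC a⟩
  | add f g hf hg =>
    obtain ⟨a, ha⟩ := hf
    obtain ⟨b, hb⟩ := hg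
    exact ⟨a + b, by rw [map_add, map_add, ha, hb]⟩
  | mul_X g i hg =>
    obtain ⟨a, ha⟩ := hg
    refine ⟨a * (algebraMap _ _ (algebraMap k (ConeRing V W) (aeval w (linearForm l))⁻¹) *
      reesElem _ (coneGen_mem_centerIdeal V l i)), ?_⟩
    rw [map_mul, map_mul, map_mul, ha, hC, coneLeadingForm_reesElem, ← mul_assoc (algebraMap k _ _),
      ← map_mul, inv_mul_cancel₀ hl, map_one, one_mul]
    rfl

theorem mem_smul_of_coneLeadingForm_eq_zero (hl : aeval w (linearForm l) ≠ (0 : k)) (d : ℕ)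
    (s : reesAlgebra (centerIdeal V W l)) (hs : s ∈ reesGrading _ d)
    (h0 : coneLeadingForm V hw l s = 0) :
    s ∈ RingHom.ker (evalVertex V W) •
      (reesGrading (centerIdeal V W l) d) := by
  obtain ⟨r, hr⟩ := (mem_reesGrading _).mp hs
  rw [coneLeadingForm, leadingForm_apply V.grading _ _ _ hr] at h0
  have hrQ : r ∈ centerIdeal V W l ^ d := by
    have := s.2 d
    rwa [← hr, Polynomial.coeff_monomial_same] at this
  have h1 := mem_mul_pow_of_decompose_eq_zero V.grading (sliceHom V hw) _ (coneGen V W l)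
    (RingHom.ker (evalVertex V W)) (evalVertex V W)
    (fun r => ker_evalVertex V W ▸ sub_evalVertex_mem_span V W r) rfl
    (fun r hr => sliceHom_mem_irrelevant V hw hr) (sliceHom_coneGen_mem V hw l)
    (fun d F hF hF0 => by
      refine aeval_coneGen_eq_zero V W l hF ?_
      simp only [sliceHom_coneGen] at hF0
      rw [aeval_mul_left_of_isHomogeneous _ _ hF] at hF0
      refine (mul_eq_zero.mp hF0).resolve_left (pow_ne_zero _ ?_)
      exact (map_ne_zero_iff _ (algebraMap k V.CoordRing).injective).mpr hl) hrQ h0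
  exact mem_smul_reesGrading h1 hr

end Slice

section Geometry

open MvPolynomial

theorem isIso_restrict_iSup {X Y : Scheme.{u}} (f : X ⟶ Y) {ι : Type*} (U : ι → Y.Opens)
    (h : ∀ i, IsIso (f ∣_ U i)) : IsIso (f ∣_ ⨆ i, U i) := by
  refine IsZariskiLocalAtTarget.of_iSup_eq_top (P := MorphismProperty.isomorphisms Scheme)
    (fun i => (⨆ i, U i).ι ⁻¹ᵁ U i) ?_ fun i => ?_
  · apply (⨆ i, U i).ι.image_injective
    beta_reduce
    rw [Scheme.Hom.image_iSup, Scheme.Hom.image_top_eq_opensRange, Scheme.Opens.opensRange_ι]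
    simp [Scheme.Hom.image_preimage_eq_opensRange_inf, le_iSup U]
  · refine ((MorphismProperty.isomorphisms Scheme).arrow_mk_iso_iff
      (morphismRestrictRestrict f _ _)).mpr ?_
    have h1 : (⨆ i, U i).ι ''ᵁ ((⨆ i, U i).ι ⁻¹ᵁ U i) = U i := by
      simp [Scheme.Hom.image_preimage_eq_opensRange_inf, le_iSup U]
    rw [h1]
    exact h i

theorem exists_zero_of_notMem {k σ : Type*} [Field k] [IsAlgClosed k] [Finite σ]
    {P : Ideal (MvPolynomial σ k)} (hP : P.IsPrime) {f : MvPolynomial σ k} (hf : f ∉ P) :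
    ∃ w : σ → k, P ≤ RingHom.ker (aeval w : _ →ₐ[k] k) ∧ aeval w f ≠ (0 : k) := by
  rw [← IsPrime.vanishingIdeal_zeroLocus (K := k) P, mem_vanishingIdeal_iff] at hf
  push Not at hf
  obtain ⟨w, hw, hw'⟩ := hf
  exact ⟨w, fun g hg => hw g hg, hw'⟩

variable {k : Type u} [Field k] {n m : ℕ} (V : ProjVariety k n) {W : ProjVariety k m}

theorem ProjVariety.exists_coord_ne_zero : ∃ i, V.coord i ≠ 0 := by
  obtain ⟨i, hi⟩ := V.exists_notMem
  exact ⟨i, fun h => hi (Ideal.Quotient.eq_zero_iff_mem.mp h)⟩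

theorem coneCoord_eq_zero {i : Fin (n + 1)} (hi : V.coord i = 0) (j : Fin (m + 1)) :
    coneCoord V W (i, j) = 0 := by
  apply coneEmb_injective
  rw [coneEmb_coneCoord, hi, TensorProduct.zero_tmul, map_zero]

theorem punctured_eq_iSup : punctured V W =
    ⨆ ij : {i // V.coord i ≠ 0} × Fin (m + 1),
      (PrimeSpectrum.basicOpen (coneCoord V W (ij.1, ij.2)) : (cone V W).Opens) := by
  refine le_antisymm (fun x hx => ?_) (iSup_le fun ij x hx hxv => hx ?_)
  · by_contra h
    apply hx
    have h1 : ∀ ij, coneCoord V W ij ∈ x.asIdeal := by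
      rintro ⟨i, j⟩
      by_cases hi : V.coord i = 0
      · rw [coneCoord_eq_zero V hi]
        exact zero_mem _
      · by_contra hij
        exact h (TopologicalSpace.Opens.mem_iSup.mpr ⟨(⟨i, hi⟩, j), hij⟩)
    have h2 : RingHom.ker (evalVertex V W) ≤ x.asIdeal := by
      rw [ker_evalVertex, Ideal.span_le]
      rintro _ ⟨ij, rfl⟩
      exact h1 ij
    have h3 : (RingHom.ker (evalVertex V W)).IsMaximal :=
      (PrimeSpectrum.isClosed_singleton_iff_isMaximal _).mp (isClosed_vertex V W)
    exact PrimeSpectrum.ext (h3.eq_of_le (PrimeSpectrum.isPrime x).ne_top h2).symm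
  · have : x = vertex V W := hxv
    rw [this]
    exact evalVertex_coneCoord V W _

theorem isIso_restrict_punctured {l : Fin (m + 1) → k} (hl : linearForm l ∉ W.ideal.toIdeal) :
    IsIso ((affineBlowupMap (centerIdeal V W l) : _ ⟶ cone V W) ∣_ punctured V W) := by
  rw [punctured_eq_iSup]
  refine isIso_restrict_iSup _ _ ?_
  rintro ⟨⟨i, hi⟩, j⟩
  refine isIso_affineBlowupMap_restrict (coneGen_mem_centerIdeal V l i)
    (coneGen_mem_nonZeroDivisors V W hl hi) fun r hr => ?_
  induction hr using Submodule.span_induction with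
  | mem r hr =>
    obtain ⟨i', rfl⟩ := hr
    rw [mul_comm, coneGen_mul_coneCoord]
    exact Ideal.mul_mem_right _ _ (Ideal.mem_span_singleton_self _)
  | zero => simp
  | add a b _ _ ha hb =>
    rw [mul_add]
    exact Ideal.add_mem _ ha hb
  | smul c a _ ha =>
    rw [smul_eq_mul, mul_left_comm]
    exact Ideal.mul_mem_left _ _ ha

/-- The inclusion of the vertex in the cone. -/
def vertexι (W : ProjVariety k m) : Spec (.of k) ⟶ cone V W :=
  Spec.map (CommRingCat.ofHom (evalVertex V W).toRingHom)

theorem vertexι_coneToSpec : vertexι V W ≫ coneToSpec V W = 𝟙 _ := by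
  have h : (evalVertex V W).toRingHom.comp (algebraMap k (ConeRing V W)) = RingHom.id k :=
    (evalVertex V W).comp_algebraMap
  refine (Spec.map_comp (CommRingCat.ofHom (algebraMap k (ConeRing V W)))
    (CommRingCat.ofHom (evalVertex V W).toRingHom)).symm.trans ?_
  rw [← CommRingCat.ofHom_comp, h]
  exact Spec.map_id _

theorem vertexι_closedPoint : vertexι V W (IsLocalRing.closedPoint k) = vertex V W := by
  refine PrimeSpectrum.ext ?_
  change (IsLocalRing.maximalIdeal k).comap (evalVertex V W).toRingHom = _
  rw [IsLocalRing.maximalIdeal_eq_bot]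
  rfl

theorem fiberι_comp_appTop_eq_zero {R : Type u} [CommRing R] {X : Scheme.{u}}
    (f : X ⟶ Spec (.of R)) (y : Spec (.of R)) {r : R} (hr : r ∈ y.asIdeal) :
    (f.fiberι y ≫ f).appTop ((Scheme.ΓSpecIso (.of R)).inv r) = 0 := by
  rw [Scheme.Hom.fiber_fac, Scheme.Hom.comp_appTop]
  exact (congrArg (f.fiberToSpecResidueField y).appTop.hom
    (fromSpecResidueField_appTop_eq_zero y hr)).trans (map_zero _)

theorem exists_fiber_iso_proj {R S A τ : Type u} [CommRing R] [CommRing S] [Algebra R S]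
    [CommRing A] [SetLike τ A] [AddSubgroupClass τ A] (𝒮 : ℕ → Submodule R S) [GradedAlgebra 𝒮]
    {𝒜 : ℕ → τ} [GradedRing 𝒜] (φ : 𝒮 →+*ᵍ 𝒜) (h : HomogeneousIdeal.irrelevant 𝒜 ≤
      (HomogeneousIdeal.irrelevant 𝒮).map φ) (hφ : Function.Surjective φ)
    (y : Spec (.of R)) (hy : IsClosed {y})
    (hker : ∀ d, ∀ s ∈ 𝒮 d, φ s = 0 → s ∈ y.asIdeal • 𝒮 d)
    (t : Proj 𝒜 ⟶ Spec ((Spec (.of R)).residueField y))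
    (ht : Proj.map φ h ≫ projToSpec 𝒮 = t ≫ (Spec (.of R)).fromSpecResidueField y) :
    ∃ e : (projToSpec 𝒮).fiber y ≅ Proj 𝒜, e.hom ≫ Proj.map φ h = (projToSpec 𝒮).fiberι y := by
  have : IsClosedImmersion (Proj.map φ h) := isClosedImmersion_projMap φ h hφ
  have : IsClosedImmersion ((Spec (.of R)).fromSpecResidueField y) :=
    isClosed_singleton_iff_isClosedImmersion.mp hy
  have : IsClosedImmersion ((projToSpec 𝒮).fiberι y) :=
    inferInstanceAs (IsClosedImmersion (Limits.pullback.fst _ _))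
  exact exists_fiber_iso _ y _ t ht (ker_projMap_le_ker 𝒮 φ h hφ hker _
    fun r hr => fiberι_comp_appTop_eq_zero _ y hr)

theorem exists_fiber_vertex_iso [IsAlgClosed k] {l : Fin (m + 1) → k}
    (hl : linearForm l ∉ W.ideal.toIdeal) (f : affineBlowup (centerIdeal V W l) ⟶ cone V W)
    (hf : f = affineBlowupMap (centerIdeal V W l)) :
    ∃ e : f.fiber (vertex V W) ≅ V.toScheme,
      e.hom ≫ V.toSpec = f.fiberι (vertex V W) ≫ f ≫ coneToSpec V W := by
  obtain ⟨w, hw, hwl⟩ := exists_zero_of_notMem W.isPrime hl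
  have hφ := coneLeadingForm_surjective V hw l hwl
  have h := irrelevant_le_map_of_surjective _ hφ
  obtain ⟨δ, hδ⟩ := exists_eq_comp_fromSpecResidueField _ _ (vertexι_closedPoint V (W := W))
  let i : V.toScheme ⟶ affineBlowup (centerIdeal V W l) := Proj.map (coneLeadingForm V hw l) h
  have hi : i ≫ f = V.toSpec ≫ vertexι V W := by
    rw [hf]
    exact projMap_projToSpec _ h _ (coneLeadingForm_algebraMap V hw l)
  obtain ⟨e, he⟩ : ∃ e : f.fiber (vertex V W) ≅ V.toScheme, e.hom ≫ i = f.fiberι _ := by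
    have ht : i ≫ f = (V.toSpec ≫ δ) ≫ (cone V W).fromSpecResidueField (vertex V W) := by
      rw [hi, Category.assoc, ← hδ]
    subst hf
    exact exists_fiber_iso_proj (reesGrading (centerIdeal V W l)) (coneLeadingForm V hw l) h hφ
      (vertex V W) (isClosed_vertex V W) (mem_smul_of_coneLeadingForm_eq_zero V hw l hwl)
      (V.toSpec ≫ δ) ht
  refine ⟨e, ?_⟩
  rw [← he, Category.assoc, ← Category.assoc i, hi, Category.assoc, vertexι_coneToSpec,
    Category.comp_id]

theorem exceptionalLocus_subset_fiber {X Y : Scheme.{u}} (f : X ⟶ Y) (y : Y) (U : Y.Opens)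
    (hU : ∀ x, x ∉ U → x = y) (h : IsIso (f ∣_ U)) : exceptionalLocus f ⊆ f ⁻¹' {y} := by
  intro x hx
  by_contra hxy
  have hxU : f x ∈ U := by
    by_contra hxU
    exact hxy (hU _ hxU)
  refine hx (f ⁻¹ᵁ U) hxU ?_
  rw [← morphismRestrict_ι]
  infer_instance

theorem isOpen_singleton_fiber {X Y : Scheme.{u}} (f : X ⟶ Y) (y : Y) (z : f.fiber y)
    (hz : f.fiberι y z ∉ exceptionalLocus f) : IsOpen {z} := by
  simp only [exceptionalLocus, Set.mem_ofPred_eq, not_forall, not_not] at hz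
  obtain ⟨U, hzU, hU⟩ := hz
  have hf (z : f.fiber y) : f (f.fiberι y z) = y := by
    have : f.fiberι y z ∈ f ⁻¹' {y} := f.range_fiberι y ▸ ⟨z, rfl⟩
    exact this
  have h1 : ({z} : Set (f.fiber y)) = f.fiberι y ⁻¹ᵁ U := by
    refine Set.Subset.antisymm (Set.singleton_subset_iff.mpr hzU) fun z' hz' => ?_
    refine (f.fiberι y).isEmbedding.injective ?_
    have h2 : (U.ι ≫ f) ⟨_, hz'⟩ = (U.ι ≫ f) ⟨_, hzU⟩ := (hf z').trans (hf z).symm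
    exact congrArg Subtype.val ((U.ι ≫ f).isOpenEmbedding.injective h2)
  rw [h1]
  exact (f.fiberι y ⁻¹ᵁ U).isOpen

/-- The generic point of a projective variety. -/
def ProjVariety.genericPoint : V.toScheme :=
  (⟨⊥, Ideal.isPrime_bot, fun h => by
    obtain ⟨i, hi⟩ := V.exists_coord_ne_zero
    exact hi (h (HomogeneousIdeal.mem_irrelevant_of_mem V.grading one_pos (V.coord_mem i)))⟩ :
    ProjectiveSpectrum V.grading)

theorem ProjVariety.closure_genericPoint : closure {V.genericPoint} = Set.univ := by
  refine Set.eq_univ_of_forall fun x => ?_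
  exact (ProjectiveSpectrum.le_iff_mem_closure V.grading V.genericPoint x).mp
    (bot_le : ⊥ ≤ HomogeneousIdeal.toIdeal (ProjectiveSpectrum.asHomogeneousIdeal x))

theorem ProjVariety.topologicalKrullDim_le_zero [LocallyOfFiniteType V.toSpec] {x : V.toScheme}
    (hx : IsOpen {x}) : topologicalKrullDim V.toScheme ≤ 0 := by
  have : JacobsonSpace V.toScheme := LocallyOfFiniteType.jacobsonSpace V.toSpec
  have h1 := isClosed_singleton_of_isLocallyClosed_singleton hx.isLocallyClosed
  have h2 : V.genericPoint = x := by
    obtain ⟨y, hy, hy'⟩ := mem_closure_iff.mp (V.closure_genericPoint.ge (Set.mem_univ x)) _ hx rfl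
    exact hy'.symm.trans hy
  have h3 : ({x} : Set V.toScheme) = Set.univ := by
    rw [← h1.closure_eq, ← h2, V.closure_genericPoint]
  have : Subsingleton V.toScheme :=
    ⟨fun a b => ((h3.ge (Set.mem_univ a)).trans (h3.ge (Set.mem_univ b)).symm : a = b)⟩
  have : Nonempty V.toScheme := ⟨x⟩
  exact topologicalKrullDim_zero_of_discreteTopology V.toScheme

theorem isHomogeneous_restrictToSlice (p : Fin (n + 1) → k)
    {L : MvPolynomial (Fin (n + 1) × Fin (m + 1)) k} (hL : L.IsHomogeneous 1) :
    (restrictToSlice p L).IsHomogeneous 1 := by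
  have := hL.aeval (fun ij => C (p ij.1) * (X ij.2 : MvPolynomial (Fin (m + 1)) k)) (n := 1)
    fun ij => by simpa using (isHomogeneous_C _ (p ij.1)).mul (isHomogeneous_X k ij.2)
  rwa [mul_one] at this

theorem affineBlowup_centerIdeal [IsAlgClosed k] [LocallyOfFiniteType V.toSpec]
    {l : Fin (m + 1) → k} (hl : linearForm l ∉ W.ideal.toIdeal) {Q : Ideal (ConeRing V W)}
    (hQ : Q = centerIdeal V W l) (f : affineBlowup Q ⟶ cone V W) (hf : f = affineBlowupMap Q) :
    IsIso (f ∣_ punctured V W) ∧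
    (∃ e : f.fiber (vertex V W) ≅ V.toScheme,
      e.hom ≫ V.toSpec = f.fiberι (vertex V W) ≫ f ≫ coneToSpec V W) ∧
    (0 < topologicalKrullDim V.toScheme →
      exceptionalLocus f = Set.range (f.fiberι (vertex V W))) := by
  subst hQ
  have h1 : IsIso (f ∣_ punctured V W) := by
    rw [hf]
    exact isIso_restrict_punctured V hl
  obtain ⟨e, he⟩ := exists_fiber_vertex_iso V hl f hf
  refine ⟨h1, ⟨e, he⟩, fun hdim => Set.Subset.antisymm ?_ ?_⟩
  · rw [Scheme.Hom.range_fiberι]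
    exact exceptionalLocus_subset_fiber f _ _ (fun x hx => not_not.mp hx) h1
  · rintro _ ⟨z, rfl⟩
    by_contra hz
    have h2 : IsOpen {e.hom z} := by
      rw [← Set.image_singleton]
      exact e.hom.homeomorph.isOpenMap _ (isOpen_singleton_fiber f _ z hz)
    exact hdim.not_ge (V.topologicalKrullDim_le_zero h2)

end Geometry

end ConeBlowup

end

theorem blowup_of_cone_along_cone {k : Type u} [Field k] [IsAlgClosed k] {n m : ℕ}
    (V : ConeBlowup.ProjVariety k n) (W : ConeBlowup.ProjVariety k m)
    (hV : Smooth V.toSpec) (hW : Smooth W.toSpec)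
    (p : Fin (n + 1) → k) (hp : V.IsPoint p)
    (H : Ideal (MvPolynomial (Fin (m + 1)) k))
    (hH : ConeBlowup.IsHyperplaneSection W p H) :
    IsIso (ConeBlowup.coneBlowupMap V W H ∣_ ConeBlowup.punctured V W) ∧
    (∃ e : (ConeBlowup.coneBlowupMap V W H).fiber (ConeBlowup.vertex V W) ≅ V.toScheme,
      e.hom ≫ V.toSpec =
        (ConeBlowup.coneBlowupMap V W H).fiberι (ConeBlowup.vertex V W) ≫
          ConeBlowup.coneBlowupMap V W H ≫ ConeBlowup.coneToSpec V W) ∧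
    (0 < topologicalKrullDim V.toScheme →
      ConeBlowup.exceptionalLocus (ConeBlowup.coneBlowupMap V W H) =
        Set.range ((ConeBlowup.coneBlowupMap V W H).fiberι (ConeBlowup.vertex V W))) := by
  obtain ⟨L, hL, hLW, rfl⟩ := hH
  obtain ⟨l, hl⟩ :=
    ConeBlowup.exists_eq_linearForm (ConeBlowup.isHomogeneous_restrictToSlice p hL)
  rw [hl] at hLW ⊢
  exact ConeBlowup.affineBlowup_centerIdeal V hLW (ConeBlowup.subconeIdeal_eq_span V W l)
    (ConeBlowup.coneBlowupMap V W _) rfl
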